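/- arXiv:1601.00438 — 3 statements merged into one kernel-verified Lean document; each statement's English description precedes it below -/
import Mathlib

section
/- Let K be an algebraically closed field with a non-archimedean valuation \(\nu:K\to\mathbb{R}\cup\{+\infty\}\), and let \(\mathcal P=\sum_{k=0}^n\mathcal P_kY^k\in K[Y]\) be monic of degree n. Then the multiset of valuations of the roots of \(\mathcal P\) (with multiplicities) equals the multiset of tropical roots of the min-plus polynomial \(\bigoplus_{k=0}^n\nu(\mathcal P_k)Y^k\). -/
open scoped Classical

/-- The min-plus polynomial function `ŷ ↦ min_{0 ≤ k ≤ n} (P_k + k y)`. -/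
noncomputable def tropEval (P : ℕ → WithTop ℝ) (n : ℕ) (y : ℝ) : WithTop ℝ :=
  (Finset.range (n + 1)).inf fun k => P k + (((k : ℝ) * y : ℝ) : WithTop ℝ)

/-- A finite multiset in a linear order is enumerated by a monotone family. -/
theorem Multiset.exists_monotone_ofFn {α : Type*} [LinearOrder α] {n : ℕ} (m : Multiset α)
    (hm : m.card = n) : ∃ c : Fin n → α, Monotone c ∧ m = (↑(List.ofFn c) : Multiset α) := by
  have hlen : (m.sort (· ≤ ·)).length = n := by simp [hm]
  subst hlen
  refine ⟨(m.sort (· ≤ ·)).get, ?_, ?_⟩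
  · exact (m.pairwise_sort (· ≤ ·)).sortedLE.monotone_get
  · rw [List.ofFn_get, Multiset.sort_eq]

section NonarchimedeanValuation

variable {K : Type*} [Field K] {ν : K → WithTop ℝ}

theorem val_one (hν0 : ∀ a, ν a = ⊤ ↔ a = 0) (hνmul : ∀ a b, ν (a * b) = ν a + ν b) :
    ν 1 = 0 := by
  have h := hνmul 1 1
  have h1 : ν 1 ≠ ⊤ := fun h => one_ne_zero ((hν0 1).1 h)
  lift ν 1 to ℝ using h1 with r hr
  rw [mul_one, ← hr] at h
  norm_cast at h ⊢
  linarith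

theorem val_neg (hν0 : ∀ a, ν a = ⊤ ↔ a = 0) (hνmul : ∀ a b, ν (a * b) = ν a + ν b) (a : K) :
    ν (-a) = ν a := by
  have h := hνmul (-1) (-1)
  have h1 : ν (-1) ≠ ⊤ := fun h => neg_ne_zero.2 one_ne_zero ((hν0 (-1)).1 h)
  have h2 := hνmul (-1) a
  rw [neg_mul_neg, mul_one, val_one hν0 hνmul] at h
  rw [neg_one_mul] at h2
  lift ν (-1) to ℝ using h1 with r hr
  norm_cast at h
  have hr0 : r = 0 := by linarith
  rw [h2, hr0, WithTop.coe_zero, zero_add]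

theorem min_val_le_val_sub (hν0 : ∀ a, ν a = ⊤ ↔ a = 0)
    (hνadd : ∀ a b, min (ν a) (ν b) ≤ ν (a + b))
    (hνmul : ∀ a b, ν (a * b) = ν a + ν b) (a b : K) : min (ν a) (ν b) ≤ ν (a - b) := by
  simpa [sub_eq_add_neg, val_neg hν0 hνmul] using hνadd a (-b)

theorem val_sub_le_left (hνadd : ∀ a b, min (ν a) (ν b) ≤ ν (a + b)) {a b : K} (h : ν a < ν b) :
    ν (a - b) ≤ ν a := by
  have h1 := hνadd (a - b) b
  rw [sub_add_cancel] at h1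
  exact (min_le_iff.1 h1).resolve_right h.not_ge

theorem val_sub_le_right (hν0 : ∀ a, ν a = ⊤ ↔ a = 0)
    (hνadd : ∀ a b, min (ν a) (ν b) ≤ ν (a + b))
    (hνmul : ∀ a b, ν (a * b) = ν a + ν b) {a b : K} (h : ν b < ν a) : ν (a - b) ≤ ν b := by
  rw [← neg_sub, val_neg hν0 hνmul]
  exact val_sub_le_left hνadd h

theorem tropEval_le (P : ℕ → WithTop ℝ) {n k : ℕ} (hk : k ≤ n) (y : ℝ) :
    tropEval P n y ≤ P k + (((k : ℝ) * y : ℝ) : WithTop ℝ) :=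
  Finset.inf_le (f := fun k : ℕ => P k + (((k : ℝ) * y : ℝ) : WithTop ℝ))
    (Finset.mem_range_succ_iff.2 hk)

/-- The minimum defining `tropEval` is attained, and there is a largest index attaining it. -/
theorem exists_tropEval_eq (P : ℕ → WithTop ℝ) (n : ℕ) (y : ℝ) :
    ∃ k ≤ n, tropEval P n y = P k + (((k : ℝ) * y : ℝ) : WithTop ℝ) ∧
      ∀ j ≤ n, k < j → tropEval P n y < P j + (((j : ℝ) * y : ℝ) : WithTop ℝ) := by
  obtain ⟨k₀, hk₀, h₀⟩ := Finset.exists_mem_eq_inf (Finset.range (n + 1)) ⟨0, by simp⟩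
    fun k : ℕ => P k + (((k : ℝ) * y : ℝ) : WithTop ℝ)
  let Q : ℕ → Prop := fun k => tropEval P n y = P k + (((k : ℝ) * y : ℝ) : WithTop ℝ)
  have hk₀' : k₀ ≤ n := Finset.mem_range_succ_iff.1 hk₀
  refine ⟨Nat.findGreatest Q n, Nat.findGreatest_le n, Nat.findGreatest_spec (P := Q) hk₀' h₀, ?_⟩
  intro j hj hlt
  exact lt_of_le_of_ne (tropEval_le P hj y) (Nat.findGreatest_is_greatest (P := Q) hlt hj)

open Polynomial in
/-- Multiplying by a linear factor adds `min y (ν a)` to the min-plus polynomial function. -/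
theorem tropEval_X_sub_C_mul (hν0 : ∀ a, ν a = ⊤ ↔ a = 0)
    (hνadd : ∀ a b, min (ν a) (ν b) ≤ ν (a + b))
    (hνmul : ∀ a b, ν (a * b) = ν a + ν b) (a : K) {f : K[X]} {n : ℕ} (hf : f ≠ 0)
    (hdeg : f.natDegree ≤ n) (y : ℝ) :
    tropEval (fun k => ν (((X - C a) * f).coeff k)) (n + 1) y =
      min (y : WithTop ℝ) (ν a) + tropEval (fun k => ν (f.coeff k)) n y := by
  set G := tropEval (fun k => ν (f.coeff k)) n y with hG
  have hν_zero : ν 0 = ⊤ := (hν0 0).2 rfl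
  have hle : ∀ k : ℕ, G ≤ ν (f.coeff k) + (((k : ℝ) * y : ℝ) : WithTop ℝ) := by
    intro k
    rcases le_or_gt k n with hk | hk
    · exact tropEval_le (fun k => ν (f.coeff k)) hk y
    · simp [coeff_eq_zero_of_natDegree_lt (hdeg.trans_lt hk), hν_zero]
  have hGtop : G ≠ ⊤ := by
    have h := hle f.natDegree
    have h1 : ν (f.coeff f.natDegree) ≠ ⊤ := fun h =>
      hf (leadingCoeff_eq_zero.1 ((hν0 _).1 h))
    exact ne_top_of_le_ne_top (WithTop.add_ne_top.2 ⟨h1, WithTop.coe_ne_top⟩) h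
  have hzero : ((X - C a) * f).coeff 0 = 0 - a * f.coeff 0 := by
    simp [sub_mul, mul_coeff_zero]
  have hsucc : ∀ k, ((X - C a) * f).coeff (k + 1) = f.coeff k - a * f.coeff (k + 1) := by
    intro k
    simp [sub_mul, coeff_X_mul]
  have hcast : ∀ k : ℕ, ((((k + 1 : ℕ) : ℝ) * y : ℝ) : WithTop ℝ) =
      (((k : ℝ) * y : ℝ) : WithTop ℝ) + (y : WithTop ℝ) := by
    intro k
    norm_cast
    push_cast
    ring
  have hlow_left : ∀ k : ℕ, (y : WithTop ℝ) + G ≤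
      ν (f.coeff k) + ((((k + 1 : ℕ) : ℝ) * y : ℝ) : WithTop ℝ) := by
    intro k
    rw [hcast, ← add_assoc, add_comm]
    gcongr
    exact hle k
  have hlow_right : ∀ k : ℕ, ν a + G ≤
      ν (a * f.coeff k) + (((k : ℝ) * y : ℝ) : WithTop ℝ) := by
    intro k
    rw [hνmul, add_assoc]
    gcongr
    exact hle k
  have hsub : ∀ (b c : K) (r : ℝ), min (y : WithTop ℝ) (ν a) + G ≤ ν b + (r : WithTop ℝ) →
      min (y : WithTop ℝ) (ν a) + G ≤ ν c + (r : WithTop ℝ) →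
      min (y : WithTop ℝ) (ν a) + G ≤ ν (b - c) + (r : WithTop ℝ) := by
    intro b c r hb hc
    refine le_trans (le_min hb hc) ?_
    rw [min_add_add_right]
    gcongr
    exact min_val_le_val_sub hν0 hνadd hνmul b c
  apply le_antisymm
  · obtain ⟨k, hk, hkG, hkmax⟩ := exists_tropEval_eq (fun k => ν (f.coeff k)) n y
    rw [← hG] at hkG hkmax
    rcases le_or_gt (y : WithTop ℝ) (ν a) with hya | hya
    · rw [min_eq_left hya]
      have hnext : G < ν (f.coeff (k + 1)) + (((k + 1 : ℕ) * y : ℝ) : WithTop ℝ) := by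
        rcases le_or_gt (k + 1) n with hk1 | hk1
        · exact hkmax _ hk1 (Nat.lt_succ_self k)
        · simpa [coeff_eq_zero_of_natDegree_lt (hdeg.trans_lt hk1), hν_zero]
            using lt_top_iff_ne_top.2 hGtop
      have hlead : ν (f.coeff k) + (((k + 1 : ℕ) * y : ℝ) : WithTop ℝ) = y + G := by
        rw [hcast, ← add_assoc, add_comm, hkG]
      have hlt : ν (f.coeff k) < ν (a * f.coeff (k + 1)) := by
        refine lt_of_add_lt_add_right (a := (((k + 1 : ℕ) * y : ℝ) : WithTop ℝ)) ?_
        rw [hlead, hνmul, add_assoc]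
        exact (WithTop.add_lt_add_left WithTop.coe_ne_top hnext).trans_le (by gcongr)
      refine (tropEval_le _ (Nat.succ_le_succ hk) y).trans ?_
      rw [← hlead]
      simp only [Nat.succ_eq_add_one, hsucc]
      gcongr
      exact val_sub_le_left hνadd hlt
    · rw [min_eq_right hya.le]
      have hlead : ν (a * f.coeff k) + ((k * y : ℝ) : WithTop ℝ) = ν a + G := by
        rw [hνmul, add_assoc, hkG]
      refine (tropEval_le _ (hk.trans n.le_succ) y).trans ?_
      rw [← hlead]
      rcases k with _ | k
      · rw [hzero, zero_sub, val_neg hν0 hνmul]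
      · simp only [hsucc]
        gcongr
        refine val_sub_le_right hν0 hνadd hνmul ?_
        refine lt_of_add_lt_add_right (a := (((k + 1 : ℕ) * y : ℝ) : WithTop ℝ)) ?_
        rw [hlead]
        exact (WithTop.add_lt_add_right hGtop hya).trans_le (hlow_left k)
  · refine Finset.le_inf fun k _ => ?_
    have hright := (add_le_add_left (min_le_right (y : WithTop ℝ) (ν a)) G).trans (hlow_right k)
    beta_reduce
    rcases k with _ | k
    · rw [hzero]
      exact hsub _ _ _ (by simp [hν_zero]) hright
    · rw [hsucc]
      exact hsub _ _ _
        ((add_le_add_left (min_le_left (y : WithTop ℝ) (ν a)) G).trans (hlow_left k)) hright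

open Polynomial in
theorem tropEval_prod_X_sub_C (hν0 : ∀ a, ν a = ⊤ ↔ a = 0)
    (hνadd : ∀ a b, min (ν a) (ν b) ≤ ν (a + b))
    (hνmul : ∀ a b, ν (a * b) = ν a + ν b) (s : Multiset K) (y : ℝ) :
    tropEval (fun k => ν ((s.map fun a => X - C a).prod.coeff k)) s.card y =
      ((s.map ν).map fun c => min (y : WithTop ℝ) c).sum := by
  induction s using Multiset.induction_on with
  | empty => simp [tropEval, val_one hν0 hνmul]
  | cons a s ih =>
    simp only [Multiset.map_cons, Multiset.prod_cons, Multiset.sum_cons, Multiset.card_cons]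
    rw [tropEval_X_sub_C_mul hν0 hνadd hνmul a (monic_multiset_prod_of_monic s _
      fun a _ => monic_X_sub_C a).ne_zero (natDegree_multiset_prod_X_sub_C_eq_card s).le y, ih]

end NonarchimedeanValuation

/-- Kapranov / Newton–Puiseux: over an algebraically closed field with a
non-archimedean valuation `ν`, the multiset of valuations of the roots of a
monic polynomial `f` of degree `n` equals the multiset of tropical roots of the
min-plus polynomial `⊕ₖ ν(fₖ) Yᵏ`. -/
theorem stmt_7 {K : Type*} [Field K] [IsAlgClosed K] (ν : K → WithTop ℝ)
    (hν0 : ∀ a, ν a = ⊤ ↔ a = 0)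
    (hνadd : ∀ a b, min (ν a) (ν b) ≤ ν (a + b))
    (hνmul : ∀ a b, ν (a * b) = ν a + ν b)
    (n : ℕ) (f : Polynomial K) (hmonic : f.Monic) (hdeg : f.natDegree = n) :
    ∃ c : Fin n → WithTop ℝ, Monotone c ∧
      (∀ y : ℝ, tropEval (fun k => ν (f.coeff k)) n y =
        ν (f.coeff n) + ∑ i : Fin n, min (y : WithTop ℝ) (c i)) ∧
      Multiset.map ν f.roots = (↑(List.ofFn c) : Multiset (WithTop ℝ)) := by
  have hsplit : f.Splits := IsAlgClosed.splits f
  have hcard : f.roots.card = n := hdeg ▸ hsplit.natDegree_eq_card_roots.symm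
  obtain ⟨c, hc, hroots⟩ := (f.roots.map ν).exists_monotone_ofFn (by rw [Multiset.card_map, hcard])
  refine ⟨c, hc, fun y => ?_, hroots⟩
  have hlead : ν (f.coeff n) = 0 := by
    rw [← hdeg, hmonic.coeff_natDegree, val_one hν0 hνmul]
  have hprod := tropEval_prod_X_sub_C hν0 hνadd hνmul f.roots y
  rw [← hsplit.eq_prod_roots_of_monic hmonic, hcard, hroots] at hprod
  rw [hprod, hlead, zero_add, Multiset.map_coe, Multiset.sum_coe, List.map_ofFn, List.sum_ofFn]
  rfl
end

section
/- Let \(\mathcal Q(\epsilon,Y)=\sum_{j=0}^n\mathcal Q_j(\epsilon)Y^j\) where each \(\mathcal Q_j\) is continuous on \([0,\epsilon_0)\) with values in \(\mathbb C\), and suppose \(\mathcal Q(0,\cdot)\) is not identically zero, of degree \(d\ge 0\). Then for any open ball B in \(\mathbb C\) containing all roots of \(\mathcal Q(0,\cdot)\), there exist \(\epsilon_1\in(0,\epsilon_0]\) and continuous functions \(\mathcal Z_1,\ldots,\mathcal Z_d:[0,\epsilon_1)\to\mathbb C\) such that for each \(\epsilon\in[0,\epsilon_1)\), \(\mathcal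 Z_1(\epsilon),\ldots,\mathcal Z_d(\epsilon)\) are exactly the roots of \(\mathcal Q(\epsilon,\cdot)\) lying in B, counted with multiplicities; moreover the roots of \(\mathcal Q(\epsilon,\cdot)\) outside B tend to infinity in modulus as \(\epsilon\to 0\). -/
open Filter Topology

lemma dist_le_of_chain {X : Type*} [PseudoMetricSpace X] {n : ℕ} (A : Fin n → X) (x : ℕ → X)
    {η : ℝ} {a b : ℕ} (hab : a ≤ b)
    (hA : ∀ j, a ≤ j → j ≤ b → ∃ l, dist (x j) (A l) < η)
    (hx : ∀ j, dist (x j) (x (j + 1)) < η) :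
    dist (x a) (x b) ≤ (2 + 3 * n) * η := by
  let G : SimpleGraph (Fin n) := SimpleGraph.fromRel fun k l => dist (A k) (A l) ≤ 3 * η
  have hη : 0 < η := dist_nonneg.trans_lt (hx 0)
  have hadj : ∀ k l, G.Adj k l → dist (A k) (A l) ≤ 3 * η := by
    intro k l h
    rw [SimpleGraph.fromRel_adj] at h
    rcases h.2 with h | h
    · exact h
    · rwa [dist_comm]
  have hwalk : ∀ k l (w : G.Walk k l), dist (A k) (A l) ≤ 3 * η * w.length := by
    intro k l w
    induction w with
    | nil => simp
    | @cons u v w h p ih =>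
      have := dist_triangle (A u) (A v) (A w)
      have := hadj _ _ h
      push_cast [SimpleGraph.Walk.length_cons]
      linarith
  obtain ⟨k, hk⟩ := hA a le_rfl hab
  have key : ∀ j, a ≤ j → j ≤ b → ∀ l, dist (x j) (A l) < η → G.Reachable k l := by
    intro j haj
    induction j, haj using Nat.le_induction with
    | base =>
      intro _ l hl
      by_cases hkl : k = l
      · rw [hkl]
      · refine SimpleGraph.Adj.reachable ?_
        rw [SimpleGraph.fromRel_adj]
        refine ⟨hkl, Or.inl ?_⟩
        have := dist_triangle_left (A k) (A l) (x a)
        linarith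
    | succ j haj ih =>
      intro hj l hl
      obtain ⟨m, hm⟩ := hA j haj (by omega)
      refine (ih (by omega) m hm).trans ?_
      by_cases hml : m = l
      · rw [hml]
      · refine SimpleGraph.Adj.reachable ?_
        rw [SimpleGraph.fromRel_adj]
        refine ⟨hml, Or.inl ?_⟩
        have := dist_triangle_left (A m) (A l) (x j)
        have := dist_triangle (x j) (x (j + 1)) (A l)
        have := hx j
        linarith
  obtain ⟨l, hl⟩ := hA b hab le_rfl
  obtain ⟨p, hp⟩ := (key b hab le_rfl l hl).exists_isPath
  have hlen : (p.length : ℝ) ≤ n := by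
    have := hp.length_lt
    rw [Fintype.card_fin] at this
    exact_mod_cast this.le
  have h1 := hwalk _ _ p
  have h2 : 3 * η * p.length ≤ 3 * η * n := by gcongr
  have := dist_triangle4_right (x a) (x b) (A k) (A l)
  linarith

lemma exists_perm_near {X : Type*} [PseudoMetricSpace X] {n : ℕ} (R : ℝ → Fin n → X)
    (hR : ∀ σ > 0, ∃ δ > 0, ∀ s t, |s - t| < δ →
      ∃ π : Equiv.Perm (Fin n), ∀ i, dist (R s i) (R t (π i)) < σ) {σ : ℝ} (hσ : 0 < σ) :
    ∃ p : ℝ → Equiv.Perm (Fin n), ∀ η ≥ σ, ∀ δ > σ,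
      (∀ s t, |s - t| < δ → ∃ π : Equiv.Perm (Fin n), ∀ i, dist (R s i) (R t (π i)) < η) →
      ∀ s t, 0 ≤ s → s ≤ t → t - s < δ → ∀ i,
        dist (R s (p s i)) (R t (p t i)) ≤ (4 + 3 * n) * η := by
  obtain ⟨δ₀, hδ₀, hmatch⟩ := hR σ hσ
  obtain ⟨h, hh, hhlt⟩ := exists_between (lt_min hδ₀ hσ)
  have hhδ : h < δ₀ := hhlt.trans_le (min_le_left _ _)
  have hhσ : h < σ := hhlt.trans_le (min_le_right _ _)
  choose! π hπ using hmatch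
  let q : ℕ → Equiv.Perm (Fin n) := fun j =>
    Nat.rec 1 (fun j g => g.trans (π (j * h) ((j + 1 : ℕ) * h))) j
  have hq : ∀ (j : ℕ) i, dist (R (j * h) (q j i)) (R ((j + 1 : ℕ) * h) (q (j + 1) i)) < σ := by
    intro j i
    refine hπ _ _ ?_ _
    push_cast
    rw [show (j * h - (j + 1) * h : ℝ) = -h by ring, abs_neg, abs_of_pos hh]
    exact hhδ
  let fl : ℝ → ℕ := fun t => ⌊t / h⌋₊
  have hfl : ∀ t, 0 ≤ t → fl t * h ≤ t ∧ t < fl t * h + h := by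
    intro t ht
    constructor
    · exact (le_div_iff₀ hh).1 (Nat.floor_le (div_nonneg ht hh.le))
    · have := (div_lt_iff₀ hh).1 (Nat.lt_floor_add_one (t / h))
      simp only [fl]
      linarith
  refine ⟨fun t => (q (fl t)).trans (π (fl t * h) t), ?_⟩
  intro η hη δ hδ hm s t hs hst hts i
  have hnear : ∀ t, 0 ≤ t →
      dist (R (fl t * h) (q (fl t) i)) (R t (π (fl t * h) t (q (fl t) i))) < σ := by
    intro t ht
    refine hπ _ _ ?_ _
    obtain ⟨h1, h2⟩ := hfl t ht
    rw [abs_lt]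
    constructor <;> linarith
  have hab : fl s ≤ fl t := Nat.floor_le_floor (by gcongr)
  have hchain := dist_le_of_chain (R s) (fun j => R (j * h) (q j i)) (η := η) hab ?_
    (fun j => (hq j i).trans_le hη)
  · have h1 := hnear s hs
    have h2 := hnear t (hs.trans hst)
    have h3 := dist_triangle4 (R s (π (fl s * h) s (q (fl s) i))) (R (fl s * h) (q (fl s) i))
      (R (fl t * h) (q (fl t) i)) (R t (π (fl t * h) t (q (fl t) i)))
    rw [dist_comm] at h1
    simp only [Equiv.trans_apply]
    linarith
  · intro j haj hjb
    have h1 : (fl s : ℝ) * h ≤ j * h := by gcongr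
    have h2 : (j : ℝ) * h ≤ fl t * h := by gcongr
    obtain ⟨ρ, hρ⟩ := hm s (j * h) (by
      have := hfl s hs
      have := hfl t (hs.trans hst)
      rw [abs_lt]
      constructor <;> linarith)
    refine ⟨ρ.symm (q j i), ?_⟩
    have := hρ (ρ.symm (q j i))
    rwa [Equiv.apply_symm_apply, dist_comm] at this

theorem exists_perm_continuousOn {X : Type*} [PseudoMetricSpace X] {n : ℕ} (R : ℝ → Fin n → X)
    (hR : ∀ σ > 0, ∃ δ > 0, ∀ s t, |s - t| < δ →
      ∃ π : Equiv.Perm (Fin n), ∀ i, dist (R s i) (R t (π i)) < σ) :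
    ∃ p : ℝ → Equiv.Perm (Fin n), ∀ i, ContinuousOn (fun t => R t (p t i)) (Set.Ici 0) := by
  choose p hp using fun k : ℕ => exists_perm_near R hR (σ := 1 / ((k : ℝ) + 1)) (by positivity)
  let U : Ultrafilter ℕ := hyperfilter ℕ
  have hlim : ∀ t, ∃ g, ∀ᶠ k in U, p k t = g := fun t =>
    Ultrafilter.eventually_exists_iff.1 (Eventually.of_forall fun k => ⟨_, rfl⟩)
  choose g hg using hlim
  have hU : (U : Filter ℕ) ≤ atTop := by
    rw [← Nat.cofinite_eq_atTop]; exact hyperfilter_le_cofinite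
  have hσ : Tendsto (fun k : ℕ => 1 / ((k : ℝ) + 1)) U (𝓝 0) :=
    tendsto_one_div_add_atTop_nhds_zero_nat.mono_left hU
  refine ⟨g, fun i => Metric.continuousOn_iff.2 fun s hs ε hε => ?_⟩
  let η := ε / (2 * (4 + 3 * n))
  have hη : 0 < η := by positivity
  obtain ⟨δ, hδ, hm⟩ := hR η hη
  have main : ∀ s t, 0 ≤ s → s ≤ t → t - s < δ → dist (R s (g s i)) (R t (g t i)) < ε := by
    intro s t hs hst hts
    obtain ⟨k, hks, hkt, h1, h2⟩ := ((hg s).and ((hg t).and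
      ((hσ.eventually_lt_const hη).and (hσ.eventually_lt_const hδ)))).exists
    have := hp k η h1.le δ h2 hm s t hs hst hts i
    rw [hks, hkt] at this
    refine this.trans_lt ?_
    have : (4 + 3 * (n : ℝ)) * η = ε / 2 := by
      simp only [η]; field_simp
    linarith
  refine ⟨δ, hδ, fun t ht hd => ?_⟩
  rw [Real.dist_eq, abs_lt] at hd
  rcases le_total s t with h | h
  · rw [dist_comm]; exact main s t hs h (by linarith)
  · exact main t s ht h (by linarith)

lemma exists_perm_of_map_univ_eq {α : Type*} {n : ℕ} {f g : Fin n → α}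
    (h : Multiset.map f Finset.univ.val = Multiset.map g Finset.univ.val) :
    ∃ π : Equiv.Perm (Fin n), ∀ i, g (π i) = f i := by
  classical
  have hfib : ∀ c, Nonempty ({i // f i = c} ≃ {i // g i = c}) := by
    intro c
    rw [← Fintype.card_eq]
    have := congrArg (Multiset.count c) h
    simp only [Multiset.count_map] at this
    simpa only [Fintype.card_subtype, Finset.card_def, Finset.filter_val, eq_comm] using this
  exact ⟨Equiv.ofFiberEquiv fun c => (hfib c).some, Equiv.ofFiberEquiv_map _⟩

lemma map_univ_eq_of_prod_sub_eq {n : ℕ} {A L : Fin n → ℂ}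
    (h : ∀ w ≠ 0, ∏ i, (w - A i) = ∏ i, (w - L i)) :
    Multiset.map A Finset.univ.val = Multiset.map L Finset.univ.val := by
  have hpoly : (∏ i, (Polynomial.X - Polynomial.C (A i)) : Polynomial ℂ) =
      ∏ i, (Polynomial.X - Polynomial.C (L i)) := by
    refine Polynomial.eq_of_infinite_eval_eq _ _
      ((Set.infinite_of_finite_compl (s := {0}ᶜ) (by simp)).mono fun w hw => ?_)
    simpa [Polynomial.eval_prod] using h w hw
  have hroots : ∀ B : Fin n → ℂ, (∏ i, (Polynomial.X - Polynomial.C (B i)) : Polynomial ℂ).roots =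
      Multiset.map B Finset.univ.val := by
    intro B
    rw [← Polynomial.roots_multiset_prod_X_sub_C (Multiset.map B Finset.univ.val),
      Multiset.map_map]
    rfl
  rw [← hroots, ← hroots, hpoly]

lemma eventually_exists_perm_dist_lt {T : Type*} {l : Filter T} {n : ℕ} {R : T → Fin n → ℂ}
    {A : Fin n → ℂ} {K : ℝ} (hK : ∀ᶠ t in l, ∀ i, ‖R t i‖ ≤ K)
    (h : ∀ w ≠ 0, Tendsto (fun t => ∏ i, (w - R t i)) l (𝓝 (∏ i, (w - A i))))
    {σ : ℝ} (hσ : 0 < σ) :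
    ∀ᶠ t in l, ∃ π : Equiv.Perm (Fin n), ∀ i, dist (A i) (R t (π i)) < σ := by
  refine mem_iff_ultrafilter.2 fun U hU => ?_
  obtain ⟨L, -, hL⟩ := (isCompact_univ_pi fun _ : Fin n =>
      isCompact_closedBall (0 : ℂ) K).ultrafilter_le_nhds (U.map R) (by
    rw [le_principal_iff]
    have hKU : ∀ᶠ t in (U : Filter T), ∀ i, ‖R t i‖ ≤ K := hU hK
    refine Ultrafilter.mem_map.2 (mem_of_superset hKU fun t ht i _ => ?_)
    simpa using ht i)
  have hL' : Tendsto R U (𝓝 L) := hL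
  have hLi : ∀ i, Tendsto (fun t => R t i) U (𝓝 (L i)) := tendsto_pi_nhds.1 hL'
  obtain ⟨π, hπ⟩ := exists_perm_of_map_univ_eq (map_univ_eq_of_prod_sub_eq fun w hw =>
    tendsto_nhds_unique ((h w hw).mono_left hU)
      (tendsto_finsetProd _ fun i _ => tendsto_const_nhds.sub (hLi i)))
  have : ∀ᶠ t in U, ∀ i, dist (R t i) (L i) < σ :=
    eventually_all.2 fun i => Metric.tendsto_nhds.1 (hLi i) σ hσ
  filter_upwards [this] with t ht
  exact ⟨π, fun i => by rw [← hπ, dist_comm]; exact ht _⟩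

theorem exists_continuousOn_enumeration {n : ℕ} {a K : ℝ} (ha : 0 ≤ a) (W : ℝ → Multiset ℂ)
    (hcard : ∀ t, (W t).card = n) (hK : ∀ t ∈ Set.Icc 0 a, ∀ u ∈ W t, ‖u‖ ≤ K)
    (hW : ∀ w ≠ 0, ContinuousOn (fun t => ((W t).map (w - ·)).prod) (Set.Icc 0 a)) :
    ∃ f : Fin n → ℝ → ℂ, (∀ i, ContinuousOn (f i) (Set.Icc 0 a)) ∧
      ∀ t ∈ Set.Icc 0 a, Multiset.map (fun i => f i t) Finset.univ.val = W t := by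
  have hex : ∀ t, ∃ r : Fin n → ℂ, Multiset.map r Finset.univ.val = W t := by
    intro t
    obtain ⟨m, hm⟩ := Quot.exists_rep (W t)
    have hlen : m.length = n := by rw [← hcard t, ← hm]; rfl
    subst hlen
    exact ⟨m.get, by rw [Fin.univ_val_map, List.ofFn_get]; exact hm⟩
  choose R hR using hex
  have hprod : ∀ w t, ((W t).map (w - ·)).prod = ∏ i, (w - R t i) := by
    intro w t
    rw [← hR, Multiset.map_map]
    rfl
  simp only [hprod] at hW
  have hK' : ∀ t ∈ Set.Icc 0 a, ∀ i, ‖R t i‖ ≤ K := fun t ht i =>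
    hK t ht _ (by rw [← hR t]; exact Multiset.mem_map_of_mem _ (Finset.mem_univ_val i))
  let pr : ℝ → ℝ := fun t => Set.projIcc 0 a ha t
  have hpr : ∀ t, pr t ∈ Set.Icc 0 a := fun t => (Set.projIcc 0 a ha t).2
  obtain ⟨p, hp⟩ := exists_perm_continuousOn (fun t => R (pr t)) (by
    intro σ hσ
    obtain ⟨δ, hδ, h⟩ := Metric.uniformity_basis_dist.lebesgue_number_lemma_nhdsWithin
      (K := Set.Icc 0 a)
      (U := fun s => {t | ∃ π : Equiv.Perm (Fin n), ∀ i, dist (R s i) (R t (π i)) < σ / 2})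
      isCompact_Icc (fun s hs => eventually_exists_perm_dist_lt (K := K)
        (eventually_of_mem self_mem_nhdsWithin hK') (fun w hw => hW w hw s hs) (half_pos hσ))
    refine ⟨δ, hδ, fun s t hst => ?_⟩
    obtain ⟨y, hy⟩ := h (pr s) (hpr s)
    obtain ⟨π, hπ⟩ := hy ⟨by simpa [UniformSpace.ball] using hδ, hpr s⟩
    obtain ⟨ρ, hρ⟩ := hy (a := pr t)
      ⟨(Set.abs_projIcc_sub_projIcc ha).trans_lt hst, hpr t⟩
    refine ⟨π.symm.trans ρ, fun i => ?_⟩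
    have h1 := hπ (π.symm i)
    have h2 := hρ (π.symm i)
    rw [Equiv.apply_symm_apply] at h1
    have := dist_triangle_left (R (pr s) i) (R (pr t) (ρ (π.symm i))) (R y (π.symm i))
    simp only [Equiv.trans_apply]
    linarith)
  refine ⟨fun i t => R (pr t) (p t i), fun i => (hp i).mono fun t ht => ht.1, fun t ht => ?_⟩
  have h1 : pr t = t := by simp only [pr, Set.projIcc_of_mem ha ht]
  simp only [h1]
  calc Multiset.map (fun i => R t (p t i)) Finset.univ.val
      = Multiset.map (R t) (Multiset.map (p t) Finset.univ.val) := (Multiset.map_map _ _ _).symm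
    _ = W t := by rw [Multiset.map_univ_val_equiv, hR]

/-- The images of the roots of `p` under `y ↦ (y - c)⁻¹`, completed to `n` points by the image `0`
of the root at infinity. -/
noncomputable def invertedRoots (n : ℕ) (c : ℂ) (p : Polynomial ℂ) : Multiset ℂ :=
  p.roots.map (fun y => (y - c)⁻¹) + Multiset.replicate (n - p.roots.card) 0

section invertedRoots

variable {n : ℕ} {c : ℂ} {p : Polynomial ℂ}

lemma card_invertedRoots (hp : p.natDegree ≤ n) : (invertedRoots n c p).card = n := by
  have := (Polynomial.card_roots' p).trans hp
  simp [invertedRoots]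
  omega

lemma prod_sub_invertedRoots (hp : p.natDegree ≤ n) (hc : p.eval c ≠ 0) {w : ℂ} (hw : w ≠ 0) :
    ((invertedRoots n c p).map (w - ·)).prod = w ^ n * (p.eval (c + w⁻¹) / p.eval c) := by
  have hcard := (Polynomial.card_roots' p).trans hp
  have hsplit := IsAlgClosed.splits p
  have hroot : ∀ y ∈ p.roots, w - (y - c)⁻¹ = w * ((c + w⁻¹ - y) / (c - y)) := by
    intro y hy
    have hyc : c - y ≠ 0 := by
      intro h
      rw [sub_eq_zero] at h
      exact hc (h ▸ (Polynomial.isRoot_of_mem_roots hy))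
    have hyc' : y - c ≠ 0 := by rwa [← neg_sub, neg_ne_zero]
    rw [← neg_sub c y, inv_neg]
    field_simp
    ring
  have hlead : p.leadingCoeff ≠ 0 := by
    intro h
    rw [Polynomial.leadingCoeff_eq_zero] at h
    simp [h] at hc
  have hw' : w ^ n = w ^ p.roots.card * w ^ (n - p.roots.card) := by
    rw [← pow_add, Nat.add_sub_cancel' hcard]
  rw [hsplit.eval_eq_prod_roots, hsplit.eval_eq_prod_roots, mul_div_mul_left _ _ hlead, hw']
  simp only [invertedRoots, Multiset.map_add, Multiset.map_map, Function.comp_def,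
    Multiset.map_replicate, sub_zero, Multiset.prod_add, Multiset.prod_replicate]
  rw [Multiset.map_congr rfl hroot, Multiset.prod_map_mul, Multiset.map_const',
    Multiset.prod_replicate, Multiset.prod_map_div]
  ring

lemma map_invertedRoots :
    (invertedRoots n c p).map (fun u => c + u⁻¹) =
      p.roots + Multiset.replicate (n - p.roots.card) c := by
  simp [invertedRoots, Multiset.map_map]

lemma norm_le_of_mem_invertedRoots {ρ : ℝ} (hρ : 0 < ρ)
    (h : ∀ y, dist y c < ρ → p.eval y ≠ 0) {u : ℂ} (hu : u ∈ invertedRoots n c p) :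
    ‖u‖ ≤ ρ⁻¹ := by
  rcases Multiset.mem_add.1 hu with hu | hu
  · obtain ⟨y, hy, rfl⟩ := Multiset.mem_map.1 hu
    have : ρ ≤ ‖y - c‖ := by
      rw [← dist_eq_norm]
      exact not_lt.1 fun hlt => h y hlt (Polynomial.isRoot_of_mem_roots hy)
    rw [norm_inv]
    gcongr
  · rw [Multiset.eq_of_mem_replicate hu, norm_zero]
    positivity

end invertedRoots

open scoped Classical

/-- Continuity of the roots of a polynomial with continuously varying
coefficients: for any open ball `B` containing the roots of `𝒬(0,·)` (of degree
`d`), there are `d` continuous branches which, for all small `ε ≥ 0`, enumerate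
exactly the roots of `𝒬(ε,·)` in `B` with multiplicities; the remaining roots
tend to infinity in modulus as `ε → 0`. -/
theorem stmt_12 (n : ℕ) (ε₀ : ℝ) (hε₀ : 0 < ε₀) (Q : ℕ → ℝ → ℂ)
    (hcont : ∀ j ≤ n, ContinuousOn (Q j) (Set.Ico 0 ε₀))
    (hne : (∑ j ∈ Finset.range (n + 1), Polynomial.C (Q j 0) * Polynomial.X ^ j) ≠ 0)
    (d : ℕ)
    (hd : d = (∑ j ∈ Finset.range (n + 1), Polynomial.C (Q j 0) * Polynomial.X ^ j).natDegree)
    (z : ℂ) (r : ℝ)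
    (hB : ∀ w : ℂ,
      (∑ j ∈ Finset.range (n + 1), Polynomial.C (Q j 0) * Polynomial.X ^ j).IsRoot w →
      w ∈ Metric.ball z r) :
    (∃ ε₁ : ℝ, 0 < ε₁ ∧ ε₁ ≤ ε₀ ∧ ∃ Z : Fin d → ℝ → ℂ,
      (∀ i, ContinuousOn (Z i) (Set.Ico 0 ε₁)) ∧
      ∀ ε ∈ Set.Ico (0 : ℝ) ε₁,
        Multiset.filter (fun w => w ∈ Metric.ball z r)
            (∑ j ∈ Finset.range (n + 1), Polynomial.C (Q j ε) * Polynomial.X ^ j).roots =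
          (↑(List.ofFn fun i => Z i ε) : Multiset ℂ)) ∧
    ∀ M : ℝ, ∃ δ : ℝ, 0 < δ ∧ ∀ ε : ℝ, 0 ≤ ε → ε < δ →
      ∀ w : ℂ,
        (∑ j ∈ Finset.range (n + 1), Polynomial.C (Q j ε) * Polynomial.X ^ j).IsRoot w →
        w ∉ Metric.ball z r → M ≤ ‖w‖ := by
  set P : ℝ → Polynomial ℂ := fun ε =>
    ∑ j ∈ Finset.range (n + 1), Polynomial.C (Q j ε) * Polynomial.X ^ j with hP
  change P 0 ≠ 0 at hne
  change d = (P 0).natDegree at hd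
  change ∀ w, (P 0).IsRoot w → _ at hB
  change (∃ ε₁ : ℝ, 0 < ε₁ ∧ ε₁ ≤ ε₀ ∧ ∃ Z : Fin d → ℝ → ℂ,
      (∀ i, ContinuousOn (Z i) (Set.Ico 0 ε₁)) ∧
      ∀ ε ∈ Set.Ico (0 : ℝ) ε₁,
        Multiset.filter (fun w => w ∈ Metric.ball z r) (P ε).roots =
          (↑(List.ofFn fun i => Z i ε) : Multiset ℂ)) ∧
    ∀ M : ℝ, ∃ δ : ℝ, 0 < δ ∧ ∀ ε : ℝ, 0 ≤ ε → ε < δ →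
      ∀ w : ℂ, (P ε).IsRoot w → w ∉ Metric.ball z r → M ≤ ‖w‖
  have hdeg : ∀ ε, (P ε).natDegree ≤ n := fun ε =>
    Polynomial.natDegree_sum_le_of_forall_le _ _ fun j hj =>
      (Polynomial.natDegree_C_mul_X_pow_le _ _).trans (Nat.lt_succ_iff.1 (Finset.mem_range.1 hj))
  have heval : ContinuousOn (fun q : ℝ × ℂ => (P q.1).eval q.2) (Set.Ico 0 ε₀ ×ˢ Set.univ) := by
    simp only [hP, Polynomial.eval_finsetSum, Polynomial.eval_mul, Polynomial.eval_C,
      Polynomial.eval_pow, Polynomial.eval_X]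
    refine continuousOn_finsetSum _ fun j hj => ContinuousOn.mul ?_ (by fun_prop)
    exact (hcont j (Nat.lt_succ_iff.1 (Finset.mem_range.1 hj))).comp continuousOn_fst
      fun q hq => hq.1
  let c : ℂ := z + |r|
  have hcB : c ∉ Metric.ball z r := by
    simp [c, dist_eq_norm, le_abs_self]
  have hc0 : (P 0).eval c ≠ 0 := fun h => hcB (hB c h)
  have h0mem : (0 : ℝ) ∈ Set.Ico 0 ε₀ := ⟨le_rfl, hε₀⟩
  obtain ⟨ρ, hρ, hρc⟩ : ∃ ρ > 0, ∀ t ∈ Set.Ico 0 ε₀, t < ρ → ∀ y, dist y c < ρ →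
      (P t).eval y ≠ 0 := by
    obtain ⟨ρ, hρ, h⟩ := Metric.mem_nhdsWithin_iff.1
      ((heval (0, c) ⟨h0mem, trivial⟩).eventually_ne hc0)
    refine ⟨ρ, hρ, fun t ht htρ y hy => h (a := (t, y)) ⟨?_, ht, trivial⟩⟩
    rw [Metric.mem_ball, Prod.dist_eq, max_lt_iff]
    exact ⟨by simpa [abs_of_nonneg ht.1] using htρ, hy⟩
  obtain ⟨a, ha, halt⟩ := exists_between (lt_min hε₀ hρ)
  have haε : a < ε₀ := halt.trans_le (min_le_left _ _)
  have haρ : a < ρ := halt.trans_le (min_le_right _ _)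
  have hsub : Set.Icc 0 a ⊆ Set.Ico 0 ε₀ := Set.Icc_subset_Ico_right haε
  have hnz : ∀ t ∈ Set.Icc 0 a, ∀ y, dist y c < ρ → (P t).eval y ≠ 0 := fun t ht =>
    hρc t (hsub ht) (ht.2.trans_lt haρ)
  have hnzc : ∀ t ∈ Set.Icc 0 a, (P t).eval c ≠ 0 := fun t ht => hnz t ht c (by simpa using hρ)
  have hevalx : ∀ x, ContinuousOn (fun t => (P t).eval x) (Set.Icc 0 a) := fun x =>
    heval.comp (f := fun t => (t, x)) (by fun_prop) fun t ht => ⟨hsub ht, trivial⟩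
  obtain ⟨f, hf, hfW⟩ := exists_continuousOn_enumeration ha.le (fun t => invertedRoots n c (P t))
    (fun t => card_invertedRoots (hdeg t))
    (fun t ht u hu => norm_le_of_mem_invertedRoots hρ (hnz t ht) hu)
    (fun w hw => (continuousOn_const.mul ((hevalx (c + w⁻¹)).div (hevalx c) hnzc)).congr
      fun t ht => prod_sub_invertedRoots (hdeg t) (hnzc t ht) hw)
  let g : Fin n → ℝ → ℂ := fun i t => c + (f i t)⁻¹
  have hg : ∀ t ∈ Set.Icc 0 a, Multiset.map (fun i => g i t) Finset.univ.val =
      (P t).roots + Multiset.replicate (n - (P t).roots.card) c := by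
    intro t ht
    rw [← map_invertedRoots, ← hfW t ht, Multiset.map_map]
    rfl
  have hfilter : ∀ t ∈ Set.Icc 0 a, (P t).roots.filter (· ∈ Metric.ball z r) =
      Multiset.map (fun i => g i t) (Finset.univ.filter fun i => g i t ∈ Metric.ball z r).val := by
    intro t ht
    have h1 : (Multiset.replicate (n - (P t).roots.card) c).filter (· ∈ Metric.ball z r) = 0 :=
      Multiset.filter_eq_nil.2 fun y hy => by rwa [Multiset.eq_of_mem_replicate hy]
    rw [Finset.filter_val, ← add_zero (Multiset.filter _ _), ← h1, ← Multiset.filter_add,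
      ← hg t ht, Multiset.filter_map]
    rfl
  have h0a : (0 : ℝ) ∈ Set.Icc 0 a := ⟨le_rfl, ha.le⟩
  have hfar : ∀ i, f i 0 = 0 → ∀ M : ℝ, ∀ᶠ t in 𝓝[Set.Icc 0 a] 0, f i t ≠ 0 → M < ‖g i t‖ := by
    intro i hi M
    have hpos : 0 < (|M| + ‖c‖ + 1)⁻¹ := by positivity
    have hi' : ‖f i 0‖ < (|M| + ‖c‖ + 1)⁻¹ := by rwa [hi, norm_zero]
    have h := ((hf i 0 h0a).norm).eventually_lt_const hi'
    filter_upwards [h] with t ht hne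
    have h2 : |M| + ‖c‖ + 1 < ‖(f i t)⁻¹‖ := by
      rw [norm_inv]
      exact (lt_inv_comm₀ (by positivity) (norm_pos_iff.2 hne)).2 ht
    have h3 : ‖(f i t)⁻¹‖ ≤ ‖g i t‖ + ‖c‖ := by
      simpa [g] using norm_sub_le (c + (f i t)⁻¹) c
    linarith [le_abs_self M]
  have hroot : ∀ t ∈ Set.Icc 0 a, ∀ i, f i t ≠ 0 → (P t).IsRoot (g i t) := by
    intro t ht i hi
    have : g i t ∈ (P t).roots + Multiset.replicate (n - (P t).roots.card) c := by
      rw [← hg t ht]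
      exact Multiset.mem_map_of_mem (fun i => g i t) (Finset.mem_univ_val i)
    rcases Multiset.mem_add.1 this with h | h
    · exact Polynomial.isRoot_of_mem_roots h
    · exact absurd (Multiset.eq_of_mem_replicate h) (by simpa [g] using hi)
  have hnear : ∀ᶠ t in 𝓝[Set.Icc 0 a] 0, ∀ i, f i 0 ≠ 0 → g i t ∈ Metric.ball z r :=
    eventually_all.2 fun i => eventually_imp_distrib_left.2 fun hi =>
      (continuousWithinAt_const.add ((hf i 0 h0a).inv₀ hi)).eventually
        (Metric.isOpen_ball.mem_nhds (hB _ (hroot 0 h0a i hi)))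
  have hout : ∀ᶠ t in 𝓝[Set.Icc 0 a] 0, ∀ i, f i 0 = 0 → g i t ∉ Metric.ball z r := by
    refine eventually_all.2 fun i => eventually_imp_distrib_left.2 fun hi => ?_
    filter_upwards [hfar i hi (‖z‖ + r)] with t ht hmem
    by_cases h : f i t = 0
    · exact hcB (by simpa [g, h] using hmem)
    · have h1 := ht h
      rw [Metric.mem_ball, dist_eq_norm] at hmem
      have := norm_le_norm_add_norm_sub' (g i t) z
      linarith
  obtain ⟨ε₂, hε₂, hsplit⟩ := Metric.mem_nhdsWithin_iff.1 (hnear.and hout)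
  have hI : ∀ t, 0 ≤ t → t < min a ε₂ → ∀ i, g i t ∈ Metric.ball z r ↔ f i 0 ≠ 0 := by
    intro t ht htlt i
    have h := hsplit (a := t) ⟨by
      simpa [abs_of_nonneg ht] using htlt.trans_le (min_le_right _ _),
      ht, (htlt.trans_le (min_le_left _ _)).le⟩
    exact ⟨fun hi h0 => h.2 i h0 hi, h.1 i⟩
  have hmin : 0 < min a ε₂ := lt_min ha hε₂
  have hlt : ∀ t ∈ Set.Ico 0 (min a ε₂), t ∈ Set.Icc 0 a := fun t ht =>
    ⟨ht.1, (ht.2.trans_le (min_le_left _ _)).le⟩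
  let I : Finset (Fin n) := Finset.univ.filter fun i => f i 0 ≠ 0
  have hfilterI : ∀ t ∈ Set.Ico 0 (min a ε₂), (P t).roots.filter (· ∈ Metric.ball z r) =
      Multiset.map (fun i => g i t) I.val := by
    intro t ht
    rw [hfilter t (hlt t ht)]
    simp only [hI t ht.1 ht.2, I]
  have hIcard : I.card = d := by
    have h1 := congrArg Multiset.card (hfilterI 0 ⟨le_rfl, hmin⟩)
    rw [Multiset.filter_eq_self.2 fun y hy => hB y (Polynomial.isRoot_of_mem_roots hy),
      Multiset.card_map, ← (IsAlgClosed.splits (P 0)).natDegree_eq_card_roots, ← hd] at h1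
    exact h1.symm
  let e := I.orderIsoOfFin hIcard
  refine ⟨⟨min a ε₂, hmin, (min_le_left _ _).trans haε.le, fun i => g (e i), fun i => ?_,
    fun t ht => ?_⟩, fun M => ?_⟩
  · refine continuousOn_const.add (((hf (e i)).mono hlt).inv₀ fun t ht h0 => hcB ?_)
    have := (hI t ht.1 ht.2 (e i)).2 (Finset.mem_filter.1 (e i).2).2
    simpa [g, h0] using this
  · calc (P t).roots.filter (· ∈ Metric.ball z r)
        = Multiset.map (fun i => g i t) I.val := hfilterI t ht
      _ = Multiset.map (fun i => g i t)
            (Finset.univ.map (I.orderEmbOfFin hIcard).toEmbedding).val := by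
          rw [Finset.map_orderEmbOfFin_univ]
      _ = Multiset.map (fun i => g (e i) t) Finset.univ.val := by
          rw [Finset.map_val, Multiset.map_map]
          rfl
      _ = _ := Fin.univ_val_map _
  · have hfarM : ∀ᶠ t in 𝓝[Set.Icc 0 a] 0, ∀ i, f i 0 = 0 → f i t ≠ 0 → M < ‖g i t‖ :=
      eventually_all.2 fun i => eventually_imp_distrib_left.2 fun hi => hfar i hi M
    obtain ⟨ε₃, hε₃, hM⟩ := Metric.mem_nhdsWithin_iff.1 hfarM
    refine ⟨min (min a ε₂) ε₃, lt_min hmin hε₃, fun t ht htlt w hw hwB => ?_⟩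
    have ht2 : t < min a ε₂ := htlt.trans_le (min_le_left _ _)
    have hta : t ∈ Set.Icc 0 a := hlt t ⟨ht, ht2⟩
    have hPt : P t ≠ 0 := fun h => hnzc t hta (by rw [h, Polynomial.eval_zero])
    have hwmem : w ∈ Multiset.map (fun i => g i t) Finset.univ.val := by
      rw [hg t hta]
      exact Multiset.mem_add.2 (Or.inl ((Polynomial.mem_roots hPt).2 hw))
    obtain ⟨i, -, rfl⟩ := Multiset.mem_map.1 hwmem
    have hi0 : f i 0 = 0 := by
      by_contra h
      exact hwB ((hI t ht ht2 i).2 h)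
    have hit : f i t ≠ 0 := by
      intro h
      refine hnzc t hta ?_
      simpa [g, h] using hw
    exact (hM (a := t) ⟨by
      simpa [abs_of_nonneg ht] using htlt.trans_le (min_le_right _ _), hta⟩ i hi0 hit).le
end

section
/- Let \(\mathcal P=\sum_{j=0}^n\mathcal P_jY^j\) be a polynomial whose coefficients are germs of continuous complex functions of \(\epsilon>0\), satisfying \(\mathcal P_j(\epsilon)=p_j\epsilon^{P_j}+o(\epsilon^{P_j})\) for some \(p_j\in\mathbb C\) and \(P_j\in\mathbb R\cup\{+\infty\}\). Let \(c\in\mathbb R\) be a finite tropical root of \(P=\bigoplus_jP_jY^j\) with multiplicity m, and suppose the complex polynomial \(p^{(c)}=\sum_{j:\hat P(c)=P_j+jc}p_jY^j\) is not identically zero, with \(\ell\) non-zero roots \(y_1,\ldots,y_\ell\). Then \(\ell\le m\), and for small \(\epsilon\), \(\mathcal P(\epsilon,\cdot)\) has \(\ell\) roots (counted with multiplicity) given by continuous branches \(\mathcal Y_i(\epsilon)\sim y_i\epsilon^c\) as \(\epsilon\to 0\). -/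
open scoped Classical

/-- `f(ε) ≃ a ε^A` as `ε → 0⁺`: i.e. `f(ε) = a ε^A + o(ε^A)`; when `A = +∞`
this means `f = 0` near `0`. -/
def simeqTo (f : ℝ → ℂ) (a : ℂ) (A : WithTop ℝ) : Prop :=
  (A = ⊤ ∧ ∀ᶠ ε in nhdsWithin 0 (Set.Ioi 0), f ε = 0) ∨
  ∃ r : ℝ, A = (r : WithTop ℝ) ∧
    Filter.Tendsto (fun ε : ℝ => f ε / ((ε ^ r : ℝ) : ℂ)) (nhdsWithin 0 (Set.Ioi 0)) (nhds a)

open Polynomial Filter Topology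

/-- The monic polynomial whose roots are the entries of the tuple `r`. -/
noncomputable def polyOfRoots {n : ℕ} (r : Fin n → ℂ) : ℂ[X] := ∏ i, (X - C (r i))

theorem roots_polyOfRoots {n : ℕ} (r : Fin n → ℂ) :
    (polyOfRoots r).roots = Finset.univ.val.map r := by
  have := roots_multiset_prod_X_sub_C (Finset.univ.val.map r)
  rwa [Multiset.map_map] at this

theorem eval_polyOfRoots {n : ℕ} (r : Fin n → ℂ) (z : ℂ) :
    (polyOfRoots r).eval z = ∏ i, (z - r i) := by
  simp [polyOfRoots, eval_prod]

theorem polyOfRoots_comp_perm {n : ℕ} (r : Fin n → ℂ) (σ : Equiv.Perm (Fin n)) :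
    polyOfRoots (r ∘ σ) = polyOfRoots r :=
  Equiv.prod_comp σ fun i => X - C (r i)

theorem exists_perm_of_map_univ_eq_s13 {ι α : Type*} [Fintype ι] (r s : ι → α)
    (h : Finset.univ.val.map r = Finset.univ.val.map s) : ∃ σ : Equiv.Perm ι, r = s ∘ σ := by
  have hcard : ∀ z, Fintype.card {i // r i = z} = Fintype.card {i // s i = z} := fun z => by
    have := congrArg (Multiset.count z) h
    rw [Multiset.count_map, Multiset.count_map] at this
    rw [Fintype.card_subtype, Fintype.card_subtype]
    simpa [Finset.card, eq_comm] using this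
  let e : ∀ z, {i // r i = z} ≃ {i // s i = z} := fun z => Fintype.equivOfCardEq (hcard z)
  refine ⟨(Equiv.sigmaFiberEquiv r).symm.trans
    ((Equiv.sigmaCongrRight e).trans (Equiv.sigmaFiberEquiv s)), funext fun i => ?_⟩
  exact (e (r i) ⟨i, rfl⟩).2.symm

theorem exists_perm_of_polyOfRoots_eq {n : ℕ} {r s : Fin n → ℂ}
    (h : polyOfRoots r = polyOfRoots s) : ∃ σ : Equiv.Perm (Fin n), r = s ∘ σ :=
  exists_perm_of_map_univ_eq_s13 r s <| by rw [← roots_polyOfRoots, h, roots_polyOfRoots]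

theorem exists_polyOfRoots_eq {n : ℕ} {p : ℂ[X]} (hp : p.Monic) (hd : p.natDegree = n) :
    ∃ r : Fin n → ℂ, polyOfRoots r = p := by
  have hs := IsAlgClosed.splits p
  have hc : p.roots.toList.length = n := by
    rw [Multiset.length_toList, ← hd, hs.natDegree_eq_card_roots]
  subst hc
  refine ⟨p.roots.toList.get, ?_⟩
  conv_rhs => rw [hs.eq_prod_roots_of_monic hp]
  conv_rhs => rw [← Multiset.coe_toList p.roots]
  rw [Multiset.map_coe, Multiset.prod_coe, polyOfRoots, ← List.prod_ofFn]
  congr 1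
  conv_rhs => rw [← List.ofFn_get p.roots.toList, List.map_ofFn]
  rfl

theorem norm_le_of_polyOfRoots_eq {n : ℕ} {r : Fin n → ℂ} {p : ℂ[X]} (hp : p.Monic)
    (h : polyOfRoots r = p) :
    ‖r‖ ≤ ∑ j ∈ Finset.range p.natDegree, ‖p.coeff j‖ + 1 := by
  refine (pi_norm_le_iff_of_nonneg (by positivity)).2 fun i => ?_
  have hroot : p.IsRoot (r i) := by
    rw [IsRoot.def, ← h, eval_polyOfRoots]
    exact Finset.prod_eq_zero (Finset.mem_univ i) (sub_self _)
  have h1 := hroot.norm_lt_cauchyBound hp.ne_zero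
  have h2 : cauchyBound p ≤ ∑ j ∈ Finset.range p.natDegree, ‖p.coeff j‖₊ + 1 := by
    rw [cauchyBound, hp.leadingCoeff]
    simp only [nnnorm_one, div_one]
    gcongr
    exact Finset.sup_le fun j hj =>
      Finset.single_le_sum (f := fun j => ‖p.coeff j‖₊) (fun _ _ => zero_le) hj
  have h3 := (h1.le.trans h2)
  rw [← NNReal.coe_le_coe] at h3
  simpa using h3

/-- Root tuples of a convergent family of monic polynomials converge along ultrafilters. -/
theorem exists_tendsto_of_tendsto_polyOfRoots {ι : Type*} (U : Ultrafilter ι) {n : ℕ}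
    {q : ι → ℂ[X]} {p : ℂ[X]} (hq : ∀ k, (q k).Monic) (hqd : ∀ k, (q k).natDegree = n)
    (hpd : p.natDegree ≤ n)
    (hlim : ∀ j, Tendsto (fun k => (q k).coeff j) U (𝓝 (p.coeff j)))
    {r : ι → Fin n → ℂ} (hr : ∀ k, polyOfRoots (r k) = q k) :
    ∃ s : Fin n → ℂ, Tendsto r U (𝓝 s) ∧ polyOfRoots s = p := by
  have hb : Tendsto (fun k => ∑ j ∈ Finset.range n, ‖(q k).coeff j‖ + 1) U
      (𝓝 (∑ j ∈ Finset.range n, ‖p.coeff j‖ + 1)) :=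
    (tendsto_finsetSum _ fun j _ => (hlim j).norm).add_const 1
  obtain ⟨B, hB⟩ : ∃ B, B = ∑ j ∈ Finset.range n, ‖p.coeff j‖ + 1 := ⟨_, rfl⟩
  rw [← hB] at hb
  have hev : ∀ᶠ k in (U : Filter ι), r k ∈ Metric.closedBall (0 : Fin n → ℂ) (B + 1) := by
    filter_upwards [hb.eventually (gt_mem_nhds (lt_add_one B))] with k hk
    rw [mem_closedBall_zero_iff]
    refine (norm_le_of_polyOfRoots_eq (hq k) (hr k)).trans ?_
    rw [hqd]
    exact hk.le
  obtain ⟨s, -, hs⟩ := (isCompact_closedBall (0 : Fin n → ℂ) (B + 1)).ultrafilter_le_nhds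
    (U.map r) (le_principal_iff.2 hev)
  have hs' : Tendsto r U (𝓝 s) := hs
  refine ⟨s, hs', Polynomial.funext fun z => ?_⟩
  have h1 : Tendsto (fun k => (q k).eval z) U (𝓝 ((polyOfRoots s).eval z)) := by
    simp_rw [← hr, eval_polyOfRoots]
    exact tendsto_finsetProd _ fun i _ => tendsto_const_nhds.sub ((tendsto_pi_nhds.1 hs') i)
  have h2 : Tendsto (fun k => (q k).eval z) U (𝓝 (p.eval z)) := by
    rw [eval_eq_sum_range' (Nat.lt_succ_of_le hpd)]
    simp_rw [fun k => eval_eq_sum_range' (Nat.lt_succ_of_le (hqd k).le) z]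
    exact tendsto_finsetSum _ fun j _ => (hlim j).mul_const _
  exact tendsto_nhds_unique h1 h2

theorem eventually_exists_polyOfRoots_dist_lt {n : ℕ} {a : ℝ → ℂ[X]}
    (hmonic : ∀ t, (a t).Monic) (hdeg : ∀ t, (a t).natDegree = n)
    (hcoeff : ∀ j, Continuous fun t => (a t).coeff j)
    {t₀ : ℝ} {r₀ : Fin n → ℂ}
    (h₀ : polyOfRoots r₀ = a t₀) {δ : ℝ} (hδ : 0 < δ) :
    ∀ᶠ t in 𝓝 t₀, ∃ r, polyOfRoots r = a t ∧ dist r r₀ < δ := by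
  refine mem_iff_ultrafilter.2 fun U hU => ?_
  choose r hr using fun t => exists_polyOfRoots_eq (hmonic t) (hdeg t)
  obtain ⟨s, hs, hsp⟩ := exists_tendsto_of_tendsto_polyOfRoots U hmonic hdeg (hdeg t₀).le
    (fun j => ((hcoeff j).tendsto t₀).mono_left hU) hr
  obtain ⟨σ, hσ⟩ := exists_perm_of_polyOfRoots_eq (h₀.trans hsp.symm)
  have hlim : Tendsto (fun t => r t ∘ σ) U (𝓝 r₀) := by
    rw [hσ]
    exact tendsto_pi_nhds.2 fun i => tendsto_pi_nhds.1 hs (σ i)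
  filter_upwards [hlim (Metric.ball_mem_nhds r₀ hδ)] with t ht
  exact ⟨r t ∘ σ, (polyOfRoots_comp_perm _ _).trans (hr t), ht⟩

theorem exists_polyOfRoots_forall_dist_le {n : ℕ} {a : ℝ → ℂ[X]}
    (hmonic : ∀ t, (a t).Monic) (hdeg : ∀ t, (a t).natDegree = n)
    (t : ℝ) (v : Fin n → ℂ) :
    ∃ r, polyOfRoots r = a t ∧ ∀ s, polyOfRoots s = a t → dist v r ≤ dist v s := by
  obtain ⟨r, hr⟩ := exists_polyOfRoots_eq (hmonic t) (hdeg t)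
  obtain ⟨σ, hσ⟩ := Finite.exists_min fun σ : Equiv.Perm (Fin n) => dist v (r ∘ σ)
  refine ⟨r ∘ σ, (polyOfRoots_comp_perm _ _).trans hr, fun s hs => ?_⟩
  obtain ⟨τ, rfl⟩ := exists_perm_of_polyOfRoots_eq (hs.trans hr.symm)
  exact hσ τ

/-- Root tuples followed greedily along a fine subdivision stay close to each other. -/
theorem exists_forall_dist_greedy_le {n : ℕ} {a : ℝ → ℂ[X]}
    (hmonic : ∀ t, (a t).Monic) (hdeg : ∀ t, (a t).natDegree = n)
    (hcoeff : ∀ j, Continuous fun t => (a t).coeff j)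
    {q : ℕ → ℕ → Fin n → ℂ}
    (hq : ∀ N k, polyOfRoots (q N k) = a (k / (N + 1)))
    (hmin : ∀ (N k : ℕ) s, polyOfRoots s = a ((k + 1 : ℕ) / (N + 1)) →
      dist (q N k) (q N (k + 1)) ≤ dist (q N k) s)
    (t₀ : ℝ) {δ : ℝ} (hδ : 0 < δ) :
    ∃ η > 0, ∀ N k l : ℕ, k ≤ l → |k / (N + 1 : ℝ) - t₀| < η → |l / (N + 1 : ℝ) - t₀| < η →
      dist (q N k) (q N l) ≤ δ := by
  obtain ⟨r₀, h₀⟩ := exists_polyOfRoots_eq (hmonic t₀) (hdeg t₀)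
  obtain ⟨d, hd, hdδ, hsep⟩ : ∃ d > 0, 2 * d < δ ∧
      ∀ i j, dist (r₀ i) (r₀ j) < 4 * d → r₀ i = r₀ j := by
    have h1 : ∀ i j, ∀ᶠ d : ℝ in 𝓝[>] 0, dist (r₀ i) (r₀ j) < 4 * d → r₀ i = r₀ j := by
      intro i j
      by_cases hij : r₀ i = r₀ j
      · exact Eventually.of_forall fun _ _ => hij
      · have hpos := dist_pos.2 hij
        filter_upwards [Ioo_mem_nhdsGT (show (0 : ℝ) < dist (r₀ i) (r₀ j) / 4 by positivity)]
          with d hd h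
        linarith [hd.2]
    obtain ⟨d, hd1, hd2⟩ := ((eventually_all.2 fun i => eventually_all.2 (h1 i)).and
      (Ioo_mem_nhdsGT (show (0 : ℝ) < δ / 2 by positivity))).exists
    exact ⟨d, hd2.1, by linarith [hd2.2], hd1⟩
  obtain ⟨η, hη, hclose⟩ := Metric.eventually_nhds_iff.1
    (eventually_exists_polyOfRoots_dist_lt hmonic hdeg hcoeff h₀ hd)
  have hnear : ∀ N k : ℕ, |k / (N + 1 : ℝ) - t₀| < η →
      ∃ σ : Equiv.Perm (Fin n), dist (q N k) (r₀ ∘ σ) < d := by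
    intro N k hk
    obtain ⟨r, hr, hrd⟩ := hclose (y := k / (N + 1 : ℝ)) hk
    obtain ⟨σ, hσ⟩ := exists_perm_of_polyOfRoots_eq ((hq N k).trans hr.symm)
    refine ⟨σ, ?_⟩
    rw [hσ, dist_pi_lt_iff hd]
    exact fun i => (dist_le_pi_dist r r₀ (σ i)).trans_lt hrd
  have hstep : ∀ N k : ℕ, |k / (N + 1 : ℝ) - t₀| < η → |(k + 1 : ℕ) / (N + 1 : ℝ) - t₀| < η →
      dist (q N k) (q N (k + 1)) < 2 * d := by
    intro N k hk hk1
    obtain ⟨σ, hσ⟩ := hnear N k hk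
    obtain ⟨r, hr, hrd⟩ := hclose (y := (k + 1 : ℕ) / (N + 1 : ℝ)) hk1
    have h2 : dist (r₀ ∘ σ) (r ∘ σ) < d := by
      rw [dist_comm, dist_pi_lt_iff hd]
      exact fun i => (dist_le_pi_dist r r₀ (σ i)).trans_lt hrd
    have h3 := hmin N k (r ∘ σ) ((polyOfRoots_comp_perm _ _).trans hr)
    linarith [dist_triangle (q N k) (r₀ ∘ σ) (r ∘ σ)]
  have hchain : ∀ N k l : ℕ, k ≤ l → |k / (N + 1 : ℝ) - t₀| < η →
      |l / (N + 1 : ℝ) - t₀| < η →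
      ∃ σ : Equiv.Perm (Fin n), dist (q N k) (r₀ ∘ σ) < d ∧ dist (q N l) (r₀ ∘ σ) < d := by
    intro N k l hkl hk
    induction l, hkl using Nat.le_induction with
    | base =>
      intro _
      obtain ⟨σ, hσ⟩ := hnear N k hk
      exact ⟨σ, hσ, hσ⟩
    | succ l hkl ih =>
      intro hl1
      have hl : |l / (N + 1 : ℝ) - t₀| < η := by
        have e1 : (k : ℝ) / (N + 1) ≤ l / (N + 1) := by gcongr
        have e2 : (l : ℝ) / (N + 1) ≤ (l + 1 : ℕ) / (N + 1) := by gcongr; simp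
        rw [abs_lt] at hk hl1 ⊢
        constructor <;> linarith
      obtain ⟨σ, hσ1, hσ2⟩ := ih hl
      obtain ⟨τ, hτ⟩ := hnear N (l + 1) hl1
      have hs := hstep N l hl hl1
      have hστ : r₀ ∘ σ = r₀ ∘ τ := funext fun i => hsep _ _ <| by
        have e1 := (dist_le_pi_dist (q N l) (r₀ ∘ σ) i).trans_lt hσ2
        have e2 := (dist_le_pi_dist (q N (l + 1)) (r₀ ∘ τ) i).trans_lt hτ
        have e3 := (dist_le_pi_dist (q N l) (q N (l + 1)) i).trans_lt hs
        have e4 := dist_triangle4 (r₀ (σ i)) (q N l i) (q N (l + 1) i) (r₀ (τ i))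
        rw [dist_comm (r₀ (σ i)) (q N l i)] at e4
        simp only [Function.comp_apply] at e1 e2
        linarith
      exact ⟨σ, hσ1, hστ ▸ hτ⟩
  refine ⟨η, hη, fun N k l hkl hk hl => ?_⟩
  obtain ⟨σ, h1, h2⟩ := hchain N k l hkl hk hl
  linarith [dist_triangle_right (q N k) (q N l) (r₀ ∘ σ)]

/-- The roots of a continuous one-parameter family of monic complex polynomials can be
followed continuously. -/
theorem exists_continuousOn_polyOfRoots_eq {n : ℕ} {a : ℝ → ℂ[X]}
    (hmonic : ∀ t, (a t).Monic) (hdeg : ∀ t, (a t).natDegree = n)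
    (hcoeff : ∀ j, Continuous fun t => (a t).coeff j) :
    ∃ u : ℝ → Fin n → ℂ, ContinuousOn u (Set.Ici 0) ∧ ∀ t, 0 ≤ t → polyOfRoots (u t) = a t := by
  choose nxt hnxt hnxt_min using exists_polyOfRoots_forall_dist_le hmonic hdeg
  let q : ℕ → ℕ → Fin n → ℂ := fun N k =>
    Nat.rec (nxt 0 0) (fun k prev => nxt ((k + 1 : ℕ) / (N + 1)) prev) k
  have hq : ∀ N k, polyOfRoots (q N k) = a (k / (N + 1)) := by
    intro N k
    cases k with
    | zero => simpa using! hnxt 0 0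
    | succ k => exact hnxt _ _
  have hfloor : ∀ t : ℝ, 0 ≤ t →
      Tendsto (fun N : ℕ => (⌊t * (N + 1)⌋₊ : ℝ) / (N + 1)) atTop (𝓝 t) := by
    intro t ht
    have := (tendsto_nat_floor_mul_div_atTop (R := ℝ) ht).comp
      ((tendsto_natCast_atTop_atTop (R := ℝ)).atTop_add (tendsto_const_nhds (x := (1 : ℝ))))
    exact this
  have hU : (hyperfilter ℕ : Filter ℕ) ≤ atTop := by
    rw [← Nat.cofinite_eq_atTop]; exact hyperfilter_le_cofinite
  have hlim : ∀ t : ℝ, ∃ s, 0 ≤ t →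
      Tendsto (fun N : ℕ => q N ⌊t * (N + 1)⌋₊) (hyperfilter ℕ) (𝓝 s) ∧ polyOfRoots s = a t := by
    intro t
    by_cases ht : 0 ≤ t
    · obtain ⟨s, hs⟩ := exists_tendsto_of_tendsto_polyOfRoots (hyperfilter ℕ)
        (fun _ => hmonic _) (fun _ => hdeg _) (hdeg t).le
        (fun j => (((hcoeff j).tendsto t).comp (hfloor t ht)).mono_left hU)
        (fun N => hq N ⌊t * (N + 1)⌋₊)
      exact ⟨s, fun _ => hs⟩
    · exact ⟨0, fun h => absurd h ht⟩
  choose u hu using hlim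
  refine ⟨u, fun t₀ ht₀ => Metric.continuousWithinAt_iff.2 fun ε hε => ?_,
    fun t ht => (hu t ht).2⟩
  obtain ⟨η, hη, hdist⟩ := exists_forall_dist_greedy_le hmonic hdeg hcoeff hq
    (fun N k s hs => hnxt_min _ _ s hs) t₀ (half_pos hε)
  refine ⟨η, hη, fun {t} ht htt => ?_⟩
  have hball : ∀ s, 0 ≤ s → |s - t₀| < η →
      ∀ᶠ N : ℕ in atTop, |(⌊s * (N + 1)⌋₊ : ℝ) / (N + 1) - t₀| < η := fun s hs hst =>
    ((hfloor s hs).sub_const t₀).abs.eventually (gt_mem_nhds hst)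
  have hle : dist (u t) (u t₀) ≤ ε / 2 := by
    refine le_of_tendsto ((hu t ht).1.dist (hu t₀ ht₀).1) (hU ?_)
    filter_upwards [hball t ht htt, hball t₀ ht₀ (by simpa using hη)] with N h1 h2
    rcases le_total ⌊t * (N + 1 : ℝ)⌋₊ ⌊t₀ * (N + 1 : ℝ)⌋₊ with h | h
    · exact hdist N _ _ h h1 h2
    · rw [dist_comm]
      exact hdist N _ _ h h2 h1
  linarith

theorem natDegree_prod_X_sub_C_le {ι : Type*} (s : Finset ι) (r : ι → ℂ) :
    (∏ i ∈ s, (X - C (r i))).natDegree ≤ s.card := by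
  simp

theorem reflect_prod_X_sub_C {ι : Type*} (s : Finset ι) (r : ι → ℂ) :
    reflect s.card (∏ i ∈ s, (X - C (r i))) = ∏ i ∈ s, (1 - C (r i) * X) := by
  induction s using Finset.induction_on with
  | empty => simp
  | insert i s hi ih =>
    rw [Finset.prod_insert hi, Finset.prod_insert hi, Finset.card_insert_of_notMem hi, add_comm,
      reflect_mul _ _ (natDegree_X_sub_C_le (r i)) (natDegree_prod_X_sub_C_le s r), ih,
      reflect_sub, reflect_C, pow_one]
    congr 2
    simp

/-- Factorization of `f` read off from the roots of its reversal about a point `w`. -/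
theorem eq_prod_of_polyOfRoots_eq_reflect {n : ℕ} {f : ℂ[X]} {w : ℂ} (hw : f.eval w ≠ 0)
    {u : Fin n → ℂ} (hu : polyOfRoots u = C (f.eval w)⁻¹ * reflect n (taylor w f)) :
    f = C (f.eval w) * ∏ i, (1 - C (u i) * (X - C w)) := by
  have h1 := congrArg (reflect n) hu
  have h2 := reflect_prod_X_sub_C Finset.univ u
  rw [Finset.card_univ, Fintype.card_fin] at h2
  have h3 : reflect n (reflect n (taylor w f)) = taylor w f := by
    ext i; simp
  rw [reflect_C_mul, h3, polyOfRoots, h2] at h1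
  have h4 : taylor w f = C (f.eval w) * ∏ i, (1 - C (u i) * X) := by
    rw [h1, ← mul_assoc, ← C_mul, mul_inv_cancel₀ hw, C_1, one_mul]
  have h5 := congrArg (fun p => p.comp (X - C w)) h4
  simpa [taylor_apply, comp_assoc, prod_comp] using h5

theorem roots_eq_of_polyOfRoots_eq_reflect {n : ℕ} {f : ℂ[X]} {w : ℂ} (hw : f.eval w ≠ 0)
    {u : Fin n → ℂ} (hu : polyOfRoots u = C (f.eval w)⁻¹ * reflect n (taylor w f)) :
    f.roots = (Finset.univ.filter fun i => u i ≠ 0).val.map fun i => w + (u i)⁻¹ := by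
  have h1 : ∏ i, (1 - C (u i) * (X - C w)) =
      ∏ i ∈ Finset.univ.filter fun i => u i ≠ 0, C (-u i) * (X - C (w + (u i)⁻¹)) := by
    rw [Finset.prod_filter]
    refine Finset.prod_congr rfl fun i _ => ?_
    split_ifs with hi
    · have : C (u i) * C (u i)⁻¹ = (1 : ℂ[X]) := by rw [← C_mul, mul_inv_cancel₀ hi, C_1]
      rw [C_neg, C_add]
      linear_combination -this
    · simp [not_not.1 hi]
  rw [eq_prod_of_polyOfRoots_eq_reflect hw hu, h1, Finset.prod_mul_distrib, ← map_prod,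
    roots_C_mul _ hw, roots_C_mul]
  · have := roots_multiset_prod_X_sub_C
      ((Finset.univ.filter fun i => u i ≠ 0).val.map fun i => w + (u i)⁻¹)
    rwa [Multiset.map_map] at this
  · exact Finset.prod_ne_zero_iff.2 fun i hi => neg_ne_zero.2 (Finset.mem_filter.1 hi).2

theorem continuous_coeff_taylor {n : ℕ} {g : ℝ → ℂ[X]} (hdeg : ∀ t, (g t).natDegree ≤ n)
    (hcoeff : ∀ j, Continuous fun t => (g t).coeff j) (w : ℂ) (i : ℕ) :
    Continuous fun t => (taylor w (g t)).coeff i := by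
  have h : ∀ t, (taylor w (g t)).coeff i =
      ∑ j ∈ Finset.range (n + 1), (g t).coeff j * (taylor w (X ^ j)).coeff i := fun t => by
    conv_lhs => rw [(g t).as_sum_range_C_mul_X_pow' (Nat.lt_succ_of_le (hdeg t))]
    simp [map_sum]
  simp_rw [h]
  exact continuous_finsetSum _ fun j _ => (hcoeff j).mul_const _

theorem coe_ofFn_comp_equiv {ι α : Type*} {l : ℕ} (S : Finset ι) (e : Fin l ≃ S) (f : ι → α) :
    (↑(List.ofFn fun k => f (e k)) : Multiset α) = S.val.map f := by
  rw [← Fin.univ_val_map, ← Multiset.attach_map_val' S.val f]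
  have h := congrArg Finset.val (Finset.univ_map_equiv_to_embedding e)
  rw [Finset.map_val] at h
  change _ = (Finset.univ : Finset S).val.map _
  rw [← h, Multiset.map_map]
  rfl

/-- The non-zero roots of a polynomial extend to continuous branches of roots of a continuous
deformation of it, even if the degree is not preserved. -/
theorem exists_continuous_branches {n : ℕ} {g : ℝ → ℂ[X]} (hdeg : ∀ t, (g t).natDegree ≤ n)
    (hcoeff : ∀ j, ContinuousOn (fun t => (g t).coeff j) (Set.Ici 0)) (hg0 : g 0 ≠ 0) {l : ℕ}
    (hl : l = (Multiset.filter (fun z => z ≠ 0) (g 0).roots).card) :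
    ∃ Y : Fin l → ℝ → ℂ, ∃ ε₁ : ℝ, 0 < ε₁ ∧
      (↑(List.ofFn fun i => Y i 0) : Multiset ℂ) =
        Multiset.filter (fun z => z ≠ 0) (g 0).roots ∧
      (∀ i, ContinuousOn (Y i) (Set.Ico 0 ε₁)) ∧ (∀ i, Y i 0 ≠ 0) ∧
      ∀ ε ∈ Set.Ico 0 ε₁, g ε ≠ 0 ∧
        (↑(List.ofFn fun i => Y i ε) : Multiset ℂ) ≤ (g ε).roots := by
  obtain ⟨w, hw⟩ : ∃ w, (g 0).eval w ≠ 0 := by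
    by_contra! h
    exact hg0 (Polynomial.funext fun z => by simpa using h z)
  have heval : ContinuousOn (fun t => (g t).eval w) (Set.Ici 0) := by
    simp_rw [fun t => eval_eq_sum_range' (Nat.lt_succ_of_le (hdeg t)) w]
    exact continuousOn_finsetSum _ fun j _ => (hcoeff j).mul continuousOn_const
  obtain ⟨η, hη, hne⟩ : ∃ η > 0, ∀ t ∈ Set.Icc 0 η, (g t).eval w ≠ 0 := by
    have := (heval 0 Set.self_mem_Ici).eventually (isOpen_ne.mem_nhds hw)
    obtain ⟨η, hη, h⟩ := mem_nhdsGE_iff_exists_Icc_subset.1 this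
    exact ⟨η, hη, fun t ht => h ht⟩
  let π : ℝ → ℝ := fun t => Set.projIcc 0 η (le_of_lt hη) t
  have hπ : Continuous π := continuous_subtype_val.comp continuous_projIcc
  have hπmem : ∀ t, π t ∈ Set.Icc 0 η := fun t => (Set.projIcc 0 η (le_of_lt hη) t).2
  have hπeq : ∀ t ∈ Set.Icc 0 η, π t = t := fun t ht =>
    congrArg Subtype.val (Set.projIcc_of_mem (le_of_lt hη) ht)
  let a : ℝ → ℂ[X] := fun t =>
    C ((g (π t)).eval w)⁻¹ * reflect n (taylor w (g (π t)))
  have hadeg_le : ∀ t, (a t).natDegree ≤ n := fun t => by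
    refine (natDegree_C_mul_le _ _).trans (natDegree_reflect_le.trans ?_)
    simp [natDegree_taylor, hdeg]
  have hacoeff : ∀ t, (a t).coeff n = 1 := fun t => by
    simp [a, coeff_reflect, taylor_coeff_zero, hne _ (hπmem t)]
  have hamonic : ∀ t, (a t).Monic := fun t =>
    monic_of_natDegree_le_of_coeff_eq_one n (hadeg_le t) (hacoeff t)
  have hadeg : ∀ t, (a t).natDegree = n := fun t =>
    (hadeg_le t).antisymm (le_natDegree_of_ne_zero (by simp [hacoeff]))
  have hπIci : ∀ t, π t ∈ Set.Ici 0 := fun t => (hπmem t).1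
  have hacont : ∀ j, Continuous fun t => (a t).coeff j := fun j => by
    simp only [a, coeff_C_mul, coeff_reflect]
    exact ((heval.comp_continuous hπ hπIci).inv₀ fun t => hne _ (hπmem t)).mul
      (continuous_coeff_taylor (fun t => hdeg (π t))
        (fun j => (hcoeff j).comp_continuous hπ hπIci) w _)
  obtain ⟨u, hu, hua⟩ := exists_continuousOn_polyOfRoots_eq hamonic hadeg hacont
  have hroots : ∀ t ∈ Set.Icc 0 η, (g t).roots =
      (Finset.univ.filter fun i => u t i ≠ 0).val.map fun i => w + (u t i)⁻¹ := fun t ht =>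
    roots_eq_of_polyOfRoots_eq_reflect (hne t ht) <| by
      rw [hua t ht.1]; simp only [a, hπeq t ht]
  let S : Finset (Fin n) := Finset.univ.filter fun i => u 0 i ≠ 0 ∧ w + (u 0 i)⁻¹ ≠ 0
  have h0 : Multiset.filter (fun z => z ≠ 0) (g 0).roots = S.val.map fun i => w + (u 0 i)⁻¹ := by
    rw [hroots 0 ⟨le_rfl, le_of_lt hη⟩, Multiset.filter_map, ← Finset.filter_val,
      Finset.filter_filter]
    rfl
  have hS : S.card = l := by rw [hl, h0, Multiset.card_map]; rfl
  let e : Fin l ≃ S := (S.equivFinOfCardEq hS).symm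
  have huc : ∀ i, ContinuousOn (fun t => u t i) (Set.Ici 0) := fun i =>
    (continuous_apply i).comp_continuousOn hu
  obtain ⟨ε₁, hε₁, hnz⟩ : ∃ ε₁ > 0, ∀ t ∈ Set.Ico 0 ε₁, t ≤ η ∧ ∀ i ∈ S, u t i ≠ 0 := by
    have h1 : ∀ i, ∀ᶠ t in 𝓝[≥] (0 : ℝ), i ∈ S → u t i ≠ 0 := fun i => by
      by_cases hi : i ∈ S
      · filter_upwards [(huc i 0 Set.self_mem_Ici).eventually
          (isOpen_ne.mem_nhds (Finset.mem_filter.1 hi).2.1)] with t ht _ using ht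
      · exact Eventually.of_forall fun _ h => absurd h hi
    have h2 : ∀ᶠ t in 𝓝[≥] (0 : ℝ), t ≤ η := mem_nhdsWithin_of_mem_nhds (Iic_mem_nhds hη)
    obtain ⟨ε₁, hε₁, h⟩ := mem_nhdsGE_iff_exists_Ico_subset.1 (h2.and (eventually_all.2 h1))
    exact ⟨ε₁, hε₁, fun t ht => h ht⟩
  refine ⟨fun k t => w + (u t (e k))⁻¹, ε₁, hε₁, ?_, fun k => ?_, fun k => ?_, fun t ht => ⟨?_, ?_⟩⟩
  · rw [h0]
    exact coe_ofFn_comp_equiv S e fun i => w + (u 0 i)⁻¹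
  · exact continuousOn_const.add (((huc (e k)).mono fun t ht => ht.1).inv₀ fun t ht =>
      (hnz t ht).2 _ (e k).2)
  · exact (Finset.mem_filter.1 (e k).2).2.2
  · rintro h
    exact hne t ⟨ht.1, (hnz t ht).1⟩ (by rw [h, eval_zero])
  · rw [coe_ofFn_comp_equiv S e fun i => w + (u t i)⁻¹, hroots t ⟨ht.1, (hnz t ht).1⟩]
    exact Multiset.map_le_map (Finset.val_le_iff.2 fun i hi =>
      Finset.mem_filter.2 ⟨Finset.mem_univ i, (hnz t ht).2 i hi⟩)

/-- The indices attaining the minimum of a tropical polynomial at a point are bounded in terms of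
the position of that point among the tropical roots. -/
theorem card_le_of_tropEval_eq {n : ℕ} {P : ℕ → WithTop ℝ} {c : Fin n → WithTop ℝ}
    (hP : P n ≠ ⊤)
    (hfact : ∀ y : ℝ, tropEval P n y = P n + ∑ i : Fin n, min (y : WithTop ℝ) (c i))
    {x : ℝ} {j : ℕ} (hj : j ≤ n)
    (h : tropEval P n x = P j + (((j : ℝ) * x : ℝ) : WithTop ℝ)) :
    (Finset.univ.filter fun i : Fin n => (x : WithTop ℝ) < c i).card ≤ j ∧
      j ≤ (Finset.univ.filter fun i : Fin n => (x : WithTop ℝ) ≤ c i).card := by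
  obtain ⟨a, ha⟩ := WithTop.ne_top_iff_exists.1 hP
  have hmin : ∀ (y : ℝ) i, ∃ r : ℝ, (r : WithTop ℝ) = min (y : WithTop ℝ) (c i) := fun y i =>
    WithTop.ne_top_iff_exists.1
      (ne_top_of_le_ne_top WithTop.coe_ne_top (min_le_left _ _))
  choose μ hμ using hmin
  have hval : ∀ y : ℝ, tropEval P n y = ((a + ∑ i, μ y i : ℝ) : WithTop ℝ) := fun y => by
    rw [hfact, ← ha, WithTop.coe_add, WithTop.coe_sum]
    simp_rw [hμ]
  obtain ⟨b, hb⟩ : ∃ b : ℝ, (b : WithTop ℝ) = P j := WithTop.ne_top_iff_exists.1 fun hbt => by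
    rw [hval, hbt, top_add] at h
    exact WithTop.coe_ne_top h
  have heq : a + ∑ i, μ x i = b + j * x := by
    rw [hval, ← hb] at h
    exact_mod_cast h
  have hle : ∀ y : ℝ, a + ∑ i, μ y i ≤ b + j * y := fun y => by
    have : tropEval P n y ≤ P j + (((j : ℝ) * y : ℝ) : WithTop ℝ) :=
      Finset.inf_le (f := fun k => P k + (((k : ℝ) * y : ℝ) : WithTop ℝ))
        (Finset.mem_range.2 (Nat.lt_succ_of_le hj))
    rw [hval, ← hb] at this
    exact_mod_cast this
  obtain ⟨δ, hδ, hup, hdown⟩ : ∃ δ > 0,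
      (∀ i, (x : WithTop ℝ) < c i → ((x + δ : ℝ) : WithTop ℝ) ≤ c i) ∧
      ∀ i, c i < (x : WithTop ℝ) → c i ≤ ((x - δ : ℝ) : WithTop ℝ) := by
    have hev : ∀ i, ∀ᶠ δ : ℝ in 𝓝[>] 0,
        ((x : WithTop ℝ) < c i → ((x + δ : ℝ) : WithTop ℝ) ≤ c i) ∧
        (c i < (x : WithTop ℝ) → c i ≤ ((x - δ : ℝ) : WithTop ℝ)) := fun i => by
      cases hci : c i with
      | top => simp
      | coe r =>
        simp only [WithTop.coe_lt_coe, WithTop.coe_le_coe]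
        rcases lt_trichotomy x r with hxr | hxr | hxr
        · filter_upwards [Ioo_mem_nhdsGT (sub_pos.2 hxr)] with δ hδ
          exact ⟨fun _ => by linarith [hδ.2], fun _ => by linarith⟩
        · exact Eventually.of_forall fun δ => ⟨fun _ => by linarith, fun _ => by linarith⟩
        · filter_upwards [Ioo_mem_nhdsGT (sub_pos.2 hxr)] with δ hδ
          exact ⟨fun _ => by linarith, fun _ => by linarith [hδ.2]⟩
    obtain ⟨δ, h1, h2⟩ := ((eventually_all.2 hev).and self_mem_nhdsWithin).exists
    exact ⟨δ, h2, fun i => (h1 i).1, fun i => (h1 i).2⟩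
  have hplus : ∀ i, μ x i + (if (x : WithTop ℝ) < c i then δ else 0) ≤ μ (x + δ) i := fun i => by
    rw [← WithTop.coe_le_coe, WithTop.coe_add, hμ, hμ]
    split_ifs with hi
    · rw [min_eq_left hi.le, min_eq_left (hup i hi), WithTop.coe_add]
    · rw [min_eq_right (not_lt.1 hi), WithTop.coe_zero, add_zero]
      refine le_min ((not_lt.1 hi).trans (WithTop.coe_le_coe.2 ?_)) le_rfl
      linarith
  have hminus : ∀ i, μ x i ≤ μ (x - δ) i + (if (x : WithTop ℝ) ≤ c i then δ else 0) := fun i => by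
    rw [← WithTop.coe_le_coe, WithTop.coe_add, hμ, hμ]
    split_ifs with hi
    · rw [min_eq_left hi, min_eq_left (le_trans (WithTop.coe_le_coe.2 (by linarith)) hi),
        ← WithTop.coe_add, sub_add_cancel]
    · rw [WithTop.coe_zero, add_zero]
      exact (min_le_right _ _).trans (le_min (hdown i (not_le.1 hi)) le_rfl)
  have hsum_plus := Finset.sum_le_sum fun i (_ : i ∈ Finset.univ) => hplus i
  have hsum_minus := Finset.sum_le_sum fun i (_ : i ∈ Finset.univ) => hminus i
  rw [Finset.sum_add_distrib, ← Finset.sum_filter, Finset.sum_const, nsmul_eq_mul]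
    at hsum_plus hsum_minus
  have hx1 := hle (x + δ)
  have hx2 := hle (x - δ)
  constructor
  · have : ((Finset.univ.filter fun i : Fin n => (x : WithTop ℝ) < c i).card : ℝ) * δ ≤ j * δ := by
      linarith
    exact_mod_cast le_of_mul_le_mul_right this hδ
  · have : (j : ℝ) * δ ≤
        ((Finset.univ.filter fun i : Fin n => (x : WithTop ℝ) ≤ c i).card : ℝ) * δ := by
      linarith
    exact_mod_cast le_of_mul_le_mul_right this hδ

theorem card_filter_ne_zero_roots_le {p : ℂ[X]} {k₁ k₂ : ℕ} (hp : p ≠ 0)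
    (hcoeff : ∀ j, p.coeff j ≠ 0 → k₁ ≤ j ∧ j ≤ k₂) :
    (Multiset.filter (fun z => z ≠ 0) p.roots).card ≤ k₂ - k₁ := by
  have h1 : k₁ ≤ p.natTrailingDegree :=
    (hcoeff _ (trailingCoeff_nonzero_iff_nonzero.2 hp)).1
  have h2 : p.natDegree ≤ k₂ := (hcoeff _ (leadingCoeff_ne_zero.2 hp)).2
  have h3 : (Multiset.filter (fun z => z = 0) p.roots).card = p.natTrailingDegree := by
    rw [← rootMultiplicity_eq_natTrailingDegree', ← count_roots, Multiset.count,
      Multiset.countP_eq_card_filter]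
    simp only [eq_comm]
  have h4 := congrArg Multiset.card (Multiset.filter_add_not (fun z => z = 0) p.roots)
  rw [Multiset.card_add, h3] at h4
  have h5 := p.card_roots'
  simp only [ne_eq]
  omega

theorem tendsto_rpow_mul_of_simeqTo {f : ℝ → ℂ} {a : ℂ} {A : WithTop ℝ} (hf : simeqTo f a A)
    {V s : ℝ} (hV : (V : WithTop ℝ) ≤ A + (s : WithTop ℝ)) :
    Tendsto (fun t : ℝ => ((t ^ (s - V) : ℝ) : ℂ) * f t) (𝓝[>] 0)
      (𝓝 (if (V : WithTop ℝ) = A + (s : WithTop ℝ) then a else 0)) := by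
  rcases hf with ⟨rfl, h⟩ | ⟨r, rfl, h⟩
  · rw [top_add, if_neg WithTop.coe_ne_top]
    refine tendsto_const_nhds.congr' ?_
    filter_upwards [h] with t ht
    rw [ht, mul_zero]
  · rw [← WithTop.coe_add] at hV ⊢
    rw [WithTop.coe_le_coe] at hV
    have hfac : (fun t : ℝ => ((t ^ (r + s - V) : ℝ) : ℂ) * (f t / ((t ^ r : ℝ) : ℂ))) =ᶠ[𝓝[>] 0]
        fun t : ℝ => ((t ^ (s - V) : ℝ) : ℂ) * f t := by
      filter_upwards [self_mem_nhdsWithin] with t ht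
      have ht' : ((t ^ r : ℝ) : ℂ) ≠ 0 := Complex.ofReal_ne_zero.2 (Real.rpow_pos_of_pos ht r).ne'
      rw [show r + s - V = r + (s - V) by ring, Real.rpow_add ht, Complex.ofReal_mul]
      field_simp
    refine Tendsto.congr' hfac ?_
    rcases hV.eq_or_lt with hVe | hVl
    · simpa [← hVe] using h
    · rw [if_neg (by exact_mod_cast hVl.ne)]
      have hpow : Tendsto (fun t : ℝ => ((t ^ (r + s - V) : ℝ) : ℂ)) (𝓝[>] 0) (𝓝 0) := by
        have := (Real.continuousAt_rpow_const 0 (r + s - V) (Or.inr (by linarith))).tendsto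
        rw [Real.zero_rpow (by linarith)] at this
        exact_mod_cast (Complex.continuous_ofReal.tendsto 0).comp
          (this.mono_left nhdsWithin_le_nhds)
      simpa using hpow.mul h

/-- Newton–Puiseux theorem with partial information on the valuations (local
version): if `𝒫_j(ε) ≃ p_j ε^{P_j}`, `x` is a finite tropical root of `P` with
multiplicity `m`, and the complex polynomial
`p^{(x)} = ∑_{j : P̂(x) = P_j + j x} p_j Y^j` is non-zero with non-zero roots
`y₁,…,y_ℓ`, then `ℓ ≤ m` and `𝒫(ε,·)` has `ℓ` roots, counted with
multiplicities, given by continuous branches `𝒴ᵢ(ε) ∼ yᵢ ε^x`. -/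
theorem stmt_13 (n : ℕ) (F : ℕ → ℝ → ℂ) (p : ℕ → ℂ) (P : ℕ → WithTop ℝ)
    (hcont : ∀ j ≤ n, ContinuousOn (F j) (Set.Ioi 0))
    (hasym : ∀ j ≤ n, simeqTo (F j) (p j) (P j))
    (hdeg : P n ≠ ⊤)
    (c : Fin n → WithTop ℝ) (hc : Monotone c)
    (hfact : ∀ y : ℝ, tropEval P n y = P n + ∑ i : Fin n, min (y : WithTop ℝ) (c i))
    (x : ℝ) (m : ℕ)
    (hm : m = (Finset.univ.filter fun i : Fin n => c i = (x : WithTop ℝ)).card)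
    (hm1 : 0 < m)
    (pc : Polynomial ℂ)
    (hpc : pc = ∑ j ∈ (Finset.range (n + 1)).filter
        (fun j => tropEval P n x = P j + (((j : ℝ) * x : ℝ) : WithTop ℝ)),
      Polynomial.C (p j) * Polynomial.X ^ j)
    (hpcne : pc ≠ 0)
    (l : ℕ) (hl : l = (Multiset.filter (fun w => w ≠ 0) pc.roots).card) :
    l ≤ m ∧
    ∃ y : Fin l → ℂ,
      (↑(List.ofFn y) : Multiset ℂ) = Multiset.filter (fun w => w ≠ 0) pc.roots ∧
      ∃ Y : Fin l → ℝ → ℂ, ∃ ε₁ : ℝ, 0 < ε₁ ∧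
        (∀ i, ContinuousOn (Y i) (Set.Ioo 0 ε₁)) ∧
        (∀ i, y i ≠ 0 ∧ simeqTo (Y i) (y i) (x : WithTop ℝ)) ∧
        ∀ ε ∈ Set.Ioo (0 : ℝ) ε₁,
          (↑(List.ofFn fun i => Y i ε) : Multiset ℂ) ≤
            (∑ j ∈ Finset.range (n + 1), Polynomial.C (F j ε) * Polynomial.X ^ j).roots := by
  obtain ⟨V, hV⟩ : ∃ V : ℝ, (V : WithTop ℝ) = tropEval P n x := by
    refine WithTop.ne_top_iff_exists.1 (ne_top_of_le_ne_top (b := P n + ((n * x : ℝ) : WithTop ℝ))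
      (WithTop.add_ne_top.2 ⟨hdeg, WithTop.coe_ne_top⟩) ?_)
    exact Finset.inf_le (f := fun k => P k + (((k : ℝ) * x : ℝ) : WithTop ℝ))
      (Finset.self_mem_range_succ n)
  have hpc_coeff : ∀ j, pc.coeff j =
      if j ≤ n ∧ (V : WithTop ℝ) = P j + (((j : ℝ) * x : ℝ) : WithTop ℝ) then p j else 0 := by
    intro j
    rw [hpc, ← hV]
    simp [finsetSum_coeff, coeff_X_pow, Finset.mem_filter]
  have hpc_deg : pc.natDegree ≤ n := natDegree_le_iff_coeff_eq_zero.2 fun j hj => by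
    rw [hpc_coeff, if_neg fun h => hj.not_ge h.1]
  refine ⟨?_, ?_⟩
  · rw [hl]
    refine (card_filter_ne_zero_roots_le
      (k₁ := (Finset.univ.filter fun i : Fin n => (x : WithTop ℝ) < c i).card)
      (k₂ := (Finset.univ.filter fun i : Fin n => (x : WithTop ℝ) ≤ c i).card)
      hpcne fun j hj => ?_).trans ?_
    · rw [hpc_coeff] at hj
      have := (ite_ne_right_iff.1 hj).1
      exact card_le_of_tropEval_eq hdeg hfact this.1 (hV ▸ this.2)
    · have hunion : (Finset.univ.filter fun i : Fin n => (x : WithTop ℝ) ≤ c i) =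
          (Finset.univ.filter fun i : Fin n => (x : WithTop ℝ) < c i) ∪
            Finset.univ.filter fun i : Fin n => c i = (x : WithTop ℝ) := by
        ext i
        simp [le_iff_lt_or_eq, eq_comm]
      rw [hm, Nat.sub_le_iff_le_add', hunion]
      exact Finset.card_union_le _ _
  let b : ℕ → ℝ → ℂ := fun j t =>
    if t ≤ 0 then pc.coeff j else ((t ^ ((j : ℝ) * x - V) : ℝ) : ℂ) * F j t
  let g : ℝ → ℂ[X] := fun t => ∑ j ∈ Finset.range (n + 1), C (b j t) * X ^ j
  have hg_coeff : ∀ t j, (g t).coeff j = if j ≤ n then b j t else 0 := fun t j => by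
    simp [g, finsetSum_coeff, coeff_X_pow]
  have hg_deg : ∀ t, (g t).natDegree ≤ n := fun t => natDegree_le_iff_coeff_eq_zero.2 fun j hj => by
    rw [hg_coeff, if_neg hj.not_ge]
  have hg0 : g 0 = pc := by
    ext j
    rw [hg_coeff]
    split_ifs with hj
    · simp [b]
    · exact (coeff_eq_zero_of_natDegree_lt (by omega)).symm
  have hb : ∀ j ≤ n, ContinuousOn (b j) (Set.Ici 0) := by
    intro j hj t ht
    rcases (Set.mem_Ici.1 ht).eq_or_lt with rfl | ht
    · rw [← continuousWithinAt_Ioi_iff_Ici]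
      have hle : (V : WithTop ℝ) ≤ P j + (((j : ℝ) * x : ℝ) : WithTop ℝ) := hV ▸
        Finset.inf_le (f := fun k => P k + (((k : ℝ) * x : ℝ) : WithTop ℝ))
          (Finset.mem_range.2 (Nat.lt_succ_of_le hj))
      have hlim := tendsto_rpow_mul_of_simeqTo (hasym j hj) hle
      have hb0 : b j 0 =
          if (V : WithTop ℝ) = P j + (((j : ℝ) * x : ℝ) : WithTop ℝ) then p j else 0 := by
        simp [b, hpc_coeff, hj]
      rw [ContinuousWithinAt, hb0]
      refine hlim.congr' ?_
      filter_upwards [self_mem_nhdsWithin] with t ht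
      exact (if_neg (not_le.2 ht)).symm
    · refine ContinuousAt.continuousWithinAt ?_
      have h1 : ContinuousAt (fun t : ℝ => ((t ^ ((j : ℝ) * x - V) : ℝ) : ℂ) * F j t) t :=
        (Complex.continuous_ofReal.continuousAt.comp
          (Real.continuousAt_rpow_const t _ (Or.inl ht.ne'))).mul
          ((hcont j hj).continuousAt (Ioi_mem_nhds ht))
      refine h1.congr ?_
      filter_upwards [Ioi_mem_nhds ht] with t ht
      exact (if_neg (not_le.2 ht)).symm
  have hg_cont : ∀ j, ContinuousOn (fun t => (g t).coeff j) (Set.Ici 0) := fun j => by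
    simp_rw [hg_coeff]
    split_ifs with hj
    · exact hb j hj
    · exact continuousOn_const
  obtain ⟨Y, ε₁, hε₁, hY0, hYc, hYne, hYr⟩ :=
    exists_continuous_branches hg_deg hg_cont (hg0 ▸ hpcne) (hg0 ▸ hl)
  refine ⟨fun i => Y i 0, hg0 ▸ hY0, fun i ε => ((ε ^ x : ℝ) : ℂ) * Y i ε, ε₁, hε₁, fun i => ?_,
    fun i => ⟨hYne i, Or.inr ⟨x, rfl, ?_⟩⟩, fun ε hε => ?_⟩
  · refine ContinuousOn.mul (fun ε hε => ?_) ((hYc i).mono Set.Ioo_subset_Ico_self)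
    exact (Complex.continuous_ofReal.continuousAt.comp
      (Real.continuousAt_rpow_const ε x (Or.inl hε.1.ne'))).continuousWithinAt
  · have hlim : Tendsto (Y i) (𝓝[>] 0) (𝓝 (Y i 0)) := by
      refine (hYc i 0 ⟨le_rfl, hε₁⟩).mono_left ?_
      rw [← nhdsWithin_Ioo_eq_nhdsGT hε₁]
      exact nhdsWithin_mono _ Set.Ioo_subset_Ico_self
    refine hlim.congr' ?_
    filter_upwards [self_mem_nhdsWithin] with ε hε
    have : ((ε ^ x : ℝ) : ℂ) ≠ 0 := Complex.ofReal_ne_zero.2 (Real.rpow_pos_of_pos hε x).ne'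
    rw [mul_div_cancel_left₀ _ this]
  · have hx0 : ((ε ^ x : ℝ) : ℂ) ≠ 0 := Complex.ofReal_ne_zero.2 (Real.rpow_pos_of_pos hε.1 x).ne'
    have hV0 : ((ε ^ (-V) : ℝ) : ℂ) ≠ 0 :=
      Complex.ofReal_ne_zero.2 (Real.rpow_pos_of_pos hε.1 _).ne'
    have hscale : g ε = C ((ε ^ (-V) : ℝ) : ℂ) *
        (∑ j ∈ Finset.range (n + 1), C (F j ε) * X ^ j).comp
          (C ((ε ^ x : ℝ) : ℂ) * X + C 0) := by
      rw [C_0, add_zero, Polynomial.sum_comp, Finset.mul_sum]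
      refine Finset.sum_congr rfl fun j _ => ?_
      have hbj : b j ε = ((ε ^ (-V) : ℝ) : ℂ) * (F j ε * ((ε ^ x : ℝ) : ℂ) ^ j) := by
        simp only [b, if_neg (not_le.2 hε.1)]
        rw [sub_eq_add_neg, Real.rpow_add hε.1, mul_comm (j : ℝ), Real.rpow_mul hε.1.le,
          Real.rpow_natCast]
        push_cast
        ring
      simp only [mul_comp, C_comp, pow_comp, X_comp, hbj, C_mul, C_pow, mul_pow]
      ring
    rw [← map_roots_comp_C_mul_X_add_C _ _ 0 (isUnit_iff_ne_zero.2 hx0),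
      ← roots_C_mul _ hV0, ← hscale]
    have h1 := Multiset.map_le_map (f := fun z => ((ε ^ x : ℝ) : ℂ) * z + 0)
      (hYr ε ⟨hε.1.le, hε.2⟩).2
    simpa [List.map_ofFn, Function.comp_def] using h1
end
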